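/- If 𝒞 is a circle decomposition of a boundaryless surface S, then 𝒞 is upper semicontinuous. -/

import Mathlib

open Topology Set

/-- A circle in a topological space `X`: a subset homeomorphic to the unit circle. -/
def IsCircle {X : Type*} [TopologicalSpace X] (C : Set X) : Prop :=
  Nonempty (C ≃ₜ Circle)

/-- A circle decomposition of `X`: a set of pairwise disjoint circles whose union is `X`. -/
def IsCircleDecomposition {X : Type*} [TopologicalSpace X] (𝒞 : Set (Set X)) : Prop :=
  (∀ C ∈ 𝒞, IsCircle C) ∧
  (∀ C ∈ 𝒞, ∀ D ∈ 𝒞, C ≠ D → Disjoint C D) ∧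
  ⋃₀ 𝒞 = Set.univ

/-- A decomposition `𝒞` of `X` is upper semicontinuous if for every `C ∈ 𝒞` and every
open `U ⊇ C` there is an open `V ⊇ C` such that every `D ∈ 𝒞` meeting `V` lies in `U`. -/
def IsUpperSemicontinuousDecomposition {X : Type*} [TopologicalSpace X]
    (𝒞 : Set (Set X)) : Prop :=
  ∀ C ∈ 𝒞, ∀ U : Set X, IsOpen U → C ⊆ U →
    ∃ V : Set X, IsOpen V ∧ C ⊆ V ∧ ∀ D ∈ 𝒞, (D ∩ V) ≠ ∅ → D ⊆ U

/-! ### Square roots and their monodromy -/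

theorem exists_continuous_sqrt {X : Type*} [TopologicalSpace X] [LocallyPathConnectedSpace X]
    [ContractibleSpace X] {u : X → ℂ} (hu : Continuous u) (h0 : ∀ x, u x ≠ 0) :
    ∃ s : X → ℂ, Continuous s ∧ ∀ x, s x ^ 2 = u x := by
  have hc : IsSimplyConnected (univ : Set X) := by
    have : ContractibleSpace (univ : Set X) :=
      (Homeomorph.Set.univ X).contractibleSpace
    exact SimplyConnectedSpace.ofContractible _
  obtain ⟨f, hf, h⟩ := Complex.exists_continuousOn_pow_eq hc isOpen_univ hu.continuousOn
    (by rintro ⟨x, -, hx⟩; exact h0 x hx) two_ne_zero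
  exact ⟨f, continuousOn_univ.1 hf, h⟩

theorem exists_continuousOn_sqrt_Icc {u : ℝ → ℂ} {a b : ℝ} (hab : a ≤ b)
    (hu : ContinuousOn u (Icc a b)) (h0 : ∀ x ∈ Icc a b, u x ≠ 0) :
    ∃ s : ℝ → ℂ, ContinuousOn s (Icc a b) ∧ ∀ x ∈ Icc a b, s x ^ 2 = u x := by
  have hc : Continuous (IccExtend hab ((Icc a b).domRestrict u)) :=
    (continuousOn_iff_continuous_domRestrict.1 hu).Icc_extend'
  obtain ⟨s, hs, h⟩ := exists_continuous_sqrt hc (fun x ↦ h0 _ (projIcc a b hab x).2)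
  refine ⟨s, hs.continuousOn, fun x hx ↦ ?_⟩
  rw [h, IccExtend_of_mem _ _ hx]; rfl

open Classical in
/-- The ratio `s b / s a` of the end values of a continuous square root `s` of `u` on `[a, b]`. -/
noncomputable def sqrtRatio (u : ℝ → ℂ) (a b : ℝ) : ℂ :=
  if h : ∃ s : ℝ → ℂ, ContinuousOn s (Icc a b) ∧ ∀ x ∈ Icc a b, s x ^ 2 = u x
  then h.choose b / h.choose a else 1

theorem sqrtRatio_eq {u s : ℝ → ℂ} {a b : ℝ} (hab : a ≤ b) (h0 : ∀ x ∈ Icc a b, u x ≠ 0)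
    (hs : ContinuousOn s (Icc a b)) (h : ∀ x ∈ Icc a b, s x ^ 2 = u x) :
    sqrtRatio u a b = s b / s a := by
  have hex : ∃ s : ℝ → ℂ, ContinuousOn s (Icc a b) ∧ ∀ x ∈ Icc a b, s x ^ 2 = u x := ⟨s, hs, h⟩
  have ha : a ∈ Icc a b := left_mem_Icc.2 hab
  have hb : b ∈ Icc a b := right_mem_Icc.2 hab
  rw [sqrtRatio, dif_pos hex]
  obtain ⟨hc, hsq⟩ := hex.choose_spec
  rcases isPreconnected_Icc.eq_or_eq_neg_of_sq_eq hc hs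
    (fun x hx ↦ by simp only [Pi.pow_apply]; rw [hsq x hx, h x hx])
    (fun {x} hx h' ↦ h0 x hx (by rw [← h x hx, h']; simp)) with h1 | h1
  · rw [h1 ha, h1 hb]
  · rw [h1 ha, h1 hb]; simp [neg_div_neg_eq]

section

variable {u v : ℝ → ℂ} {a b c : ℝ}

theorem sqrtRatio_sq (hab : a ≤ b) (hu : ContinuousOn u (Icc a b))
    (h0 : ∀ x ∈ Icc a b, u x ≠ 0) : sqrtRatio u a b ^ 2 = u b / u a := by
  obtain ⟨s, hs, h⟩ := exists_continuousOn_sqrt_Icc hab hu h0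
  rw [sqrtRatio_eq hab h0 hs h, div_pow, h _ (left_mem_Icc.2 hab), h _ (right_mem_Icc.2 hab)]

theorem sqrtRatio_ne_zero (hab : a ≤ b) (hu : ContinuousOn u (Icc a b))
    (h0 : ∀ x ∈ Icc a b, u x ≠ 0) : sqrtRatio u a b ≠ 0 := by
  intro h
  have := sqrtRatio_sq hab hu h0
  rw [h] at this
  exact div_ne_zero (h0 _ (right_mem_Icc.2 hab)) (h0 _ (left_mem_Icc.2 hab)) (by rw [← this]; simp)

theorem sqrtRatio_mul (hab : a ≤ b) (hu : ContinuousOn u (Icc a b)) (hv : ContinuousOn v (Icc a b))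
    (hu0 : ∀ x ∈ Icc a b, u x ≠ 0) (hv0 : ∀ x ∈ Icc a b, v x ≠ 0) :
    sqrtRatio (fun x ↦ u x * v x) a b = sqrtRatio u a b * sqrtRatio v a b := by
  obtain ⟨s, hs, h⟩ := exists_continuousOn_sqrt_Icc hab hu hu0
  obtain ⟨t, ht, h'⟩ := exists_continuousOn_sqrt_Icc hab hv hv0
  rw [sqrtRatio_eq hab hu0 hs h, sqrtRatio_eq hab hv0 ht h',
    sqrtRatio_eq (s := fun x ↦ s x * t x) hab (fun x hx ↦ mul_ne_zero (hu0 x hx) (hv0 x hx))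
      (hs.mul ht) (fun x hx ↦ by rw [mul_pow, h x hx, h' x hx])]
  ring

theorem sqrtRatio_trans (hab : a ≤ b) (hbc : b ≤ c) (hu : ContinuousOn u (Icc a c))
    (h0 : ∀ x ∈ Icc a c, u x ≠ 0) :
    sqrtRatio u a c = sqrtRatio u a b * sqrtRatio u b c := by
  obtain ⟨s, hs, h⟩ := exists_continuousOn_sqrt_Icc (hab.trans hbc) hu h0
  have h1 : Icc a b ⊆ Icc a c := Icc_subset_Icc_right hbc
  have h2 : Icc b c ⊆ Icc a c := Icc_subset_Icc_left hab
  have hb : s b ≠ 0 := fun h' ↦ h0 b ⟨hab, hbc⟩ (by rw [← h b ⟨hab, hbc⟩, h']; simp)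
  rw [sqrtRatio_eq (hab.trans hbc) h0 hs h,
    sqrtRatio_eq hab (fun x hx ↦ h0 x (h1 hx)) (hs.mono h1) (fun x hx ↦ h x (h1 hx)),
    sqrtRatio_eq hbc (fun x hx ↦ h0 x (h2 hx)) (hs.mono h2) (fun x hx ↦ h x (h2 hx))]
  field_simp

theorem sqrtRatio_congr (hab : a ≤ b) (hu : ContinuousOn u (Icc a b))
    (h0 : ∀ x ∈ Icc a b, u x ≠ 0) (h : EqOn u v (Icc a b)) :
    sqrtRatio u a b = sqrtRatio v a b := by
  obtain ⟨s, hs, h'⟩ := exists_continuousOn_sqrt_Icc hab hu h0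
  rw [sqrtRatio_eq hab h0 hs h', sqrtRatio_eq hab (fun x hx ↦ h hx ▸ h0 x hx) hs
    (fun x hx ↦ h hx ▸ h' x hx)]

end

/-- The principal square root. -/
noncomputable def psqrt (z : ℂ) : ℂ := Complex.exp (Complex.log z / 2)

theorem psqrt_sq {z : ℂ} (hz : z ≠ 0) : psqrt z ^ 2 = z := by
  rw [psqrt, ← Complex.exp_nat_mul]
  convert Complex.exp_log hz using 2
  push_cast; ring

theorem psqrt_ne_zero (z : ℂ) : psqrt z ≠ 0 := Complex.exp_ne_zero _

theorem psqrt_continuousAt {z : ℂ} (hz : z ∈ Complex.slitPlane) : ContinuousAt psqrt z := by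
  have := continuousAt_clog hz
  unfold psqrt
  fun_prop

theorem psqrt_re_pos {z : ℂ} (hz : z ∈ Complex.slitPlane) : 0 < (psqrt z).re := by
  rw [psqrt, Complex.exp_re]
  refine mul_pos (Real.exp_pos _) (Real.cos_pos_of_mem_Ioo ?_)
  have h1 := Complex.neg_pi_lt_log_im z
  have h2 := Complex.log_im_le_pi z
  have h3 : (Complex.log z).im ≠ Real.pi := by
    rw [Complex.log_im]; exact (Complex.mem_slitPlane_iff_arg.1 hz).1
  have h4 := lt_of_le_of_ne h2 h3
  have : (Complex.log z / 2).im = (Complex.log z).im / 2 := by simp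
  rw [this]
  constructor <;> linarith

theorem eq_of_sq_eq_of_re_pos {z w : ℂ} (h : z ^ 2 = w ^ 2) (hz : 0 < z.re) (hw : 0 < w.re) :
    z = w := by
  rcases sq_eq_sq_iff_eq_or_eq_neg.1 h with h | h
  · exact h
  · rw [h] at hz; simp at hz; linarith

theorem mem_slitPlane_of_norm_sub_one_lt {z : ℂ} (h : ‖z - 1‖ < 1) : z ∈ Complex.slitPlane := by
  simpa using Complex.mem_slitPlane_of_norm_lt_one h

theorem sqrtRatio_eq_psqrt {u : ℝ → ℂ} {a b : ℝ} (hab : a ≤ b) (hu : ContinuousOn u (Icc a b))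
    (h : ∀ x ∈ Icc a b, u x ∈ Complex.slitPlane) :
    sqrtRatio u a b = psqrt (u b) / psqrt (u a) := by
  refine sqrtRatio_eq (s := fun x ↦ psqrt (u x)) hab
    (fun x hx ↦ Complex.slitPlane_ne_zero (h x hx)) (fun x hx ↦ ?_)
    fun x hx ↦ psqrt_sq (Complex.slitPlane_ne_zero (h x hx))
  exact (psqrt_continuousAt (h x hx)).comp_continuousWithinAt (hu x hx)

/-- If `u` is a square of a function continuous on `[a, b]` taking equal values at the ends then
the ratio is one. -/
theorem sqrtRatio_eq_one {u s : ℝ → ℂ} {a b : ℝ} (hab : a ≤ b) (h0 : ∀ x ∈ Icc a b, u x ≠ 0)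
    (hs : ContinuousOn s (Icc a b)) (h : ∀ x ∈ Icc a b, s x ^ 2 = u x) (he : s a = s b) :
    sqrtRatio u a b = 1 := by
  rw [sqrtRatio_eq hab h0 hs h, he, div_self]
  intro h'
  exact h0 b (right_mem_Icc.2 hab) (by rw [← h b (right_mem_Icc.2 hab), h']; simp)

/-! ### Discs and circles -/

section

variable {S : Type*}

open Classical in
/-- In the disc `θ` the function `(ζ - z) / (ζ - w)`, extended by `1` outside the disc. -/
noncomputable def discQuot (θ : ℂ → S) (z w : ℂ) (q : S) : ℂ :=
  if q ∈ range θ then (Function.invFun θ q - z) / (Function.invFun θ q - w) else 1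

variable {θ : ℂ → S} {z w v : ℂ} {q : S}

theorem discQuot_of_notMem (hq : q ∉ range θ) : discQuot θ z w q = 1 := if_neg hq

variable [TopologicalSpace S]

theorem discQuot_apply (hθ : IsOpenEmbedding θ) (z w ζ : ℂ) :
    discQuot θ z w (θ ζ) = (ζ - z) / (ζ - w) := by
  rw [discQuot, if_pos (mem_range_self ζ), Function.leftInverse_invFun hθ.injective]

theorem discQuot_ne_zero (hθ : IsOpenEmbedding θ) (hz : q ≠ θ z) (hw : q ≠ θ w) :
    discQuot θ z w q ≠ 0 := by
  by_cases hq : q ∈ range θ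
  · obtain ⟨ζ, rfl⟩ := hq
    rw [discQuot_apply hθ]
    refine div_ne_zero (sub_ne_zero.2 fun h ↦ hz (by rw [h])) (sub_ne_zero.2 fun h ↦ hw (by rw [h]))
  · rw [discQuot_of_notMem hq]; exact one_ne_zero

theorem discQuot_mul (hθ : IsOpenEmbedding θ) (hw : q ≠ θ w) :
    discQuot θ z w q * discQuot θ w v q = discQuot θ z v q := by
  by_cases hq : q ∈ range θ
  · obtain ⟨ζ, rfl⟩ := hq
    have : ζ - w ≠ 0 := sub_ne_zero.2 fun h ↦ hw (by rw [h])
    simp only [discQuot_apply hθ]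
    rw [div_mul_div_cancel₀ this]
  · simp [discQuot_of_notMem hq]

theorem norm_discQuot_sub_one_lt (hθ : IsOpenEmbedding θ) {z₀ : ℂ} {r : ℝ} (hr : 0 < r)
    (hz : z ∈ Metric.ball z₀ (r / 3)) (hw : w ∈ Metric.ball z₀ (r / 3))
    (hq : q ∉ θ '' Metric.ball z₀ r) : ‖discQuot θ z w q - 1‖ < 1 := by
  by_cases hq' : q ∈ range θ
  · obtain ⟨ζ, rfl⟩ := hq'
    have hζ : r ≤ dist ζ z₀ := by
      by_contra h
      exact hq ⟨ζ, not_le.1 h, rfl⟩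
    rw [Metric.mem_ball] at hz hw
    have h1 : dist ζ z₀ ≤ dist ζ w + dist w z₀ := dist_triangle _ _ _
    have h2 : dist z w ≤ dist z z₀ + dist w z₀ := dist_triangle_right _ _ _
    have h3 : ζ - w ≠ 0 := by
      intro h
      rw [dist_eq_norm ζ w, h, norm_zero] at h1
      linarith
    have h4 : (ζ - z) / (ζ - w) - 1 = (w - z) / (ζ - w) := by field_simp; ring
    rw [discQuot_apply hθ, h4, norm_div, div_lt_one (norm_pos_iff.2 h3), ← dist_eq_norm,
      ← dist_eq_norm, dist_comm]
    linarith
  · simp [discQuot_of_notMem hq']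

theorem discQuot_continuousAt [T2Space S] (hθ : IsOpenEmbedding θ) (hw : q ≠ θ w) :
    ContinuousAt (discQuot θ z w) q := by
  by_cases hq : q ∈ range θ
  · obtain ⟨ζ, rfl⟩ := hq
    rw [← hθ.continuousAt_iff]
    have : discQuot θ z w ∘ θ = fun ζ ↦ (ζ - z) / (ζ - w) := by
      ext; exact discQuot_apply hθ _ _ _
    rw [this]
    have : ζ - w ≠ 0 := sub_ne_zero.2 fun h ↦ hw (by rw [h])
    fun_prop (disch := assumption)
  · rw [ContinuousAt, discQuot_of_notMem hq, Metric.tendsto_nhds]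
    intro ε hε
    have hK : IsClosed (θ '' Metric.closedBall w (‖w - z‖ / ε)) :=
      ((isCompact_closedBall _ _).image hθ.continuous).isClosed
    filter_upwards [hK.isOpen_compl.mem_nhds (fun h ↦ hq (image_subset_range _ _ h))] with p hp
    by_cases hp' : p ∈ range θ
    · obtain ⟨ζ, rfl⟩ := hp'
      have h1 : ‖w - z‖ / ε < dist ζ w := by
        by_contra h
        exact hp ⟨ζ, not_lt.1 h, rfl⟩
      have h0 : 0 < dist ζ w := lt_of_le_of_lt (by positivity) h1
      have h3 : ζ - w ≠ 0 := sub_ne_zero.2 (dist_pos.1 h0)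
      have h4 : (ζ - z) / (ζ - w) - 1 = (w - z) / (ζ - w) := by field_simp; ring
      rw [discQuot_apply hθ, dist_eq_norm, h4, norm_div, ← dist_eq_norm ζ, div_lt_iff₀ h0]
      rwa [div_lt_iff₀ hε, mul_comm] at h1
    · rwa [discQuot_of_notMem hp', dist_self]

/-- A `2π`-periodic parametrisation of a circle. -/
structure IsCircleParam (e : ℝ → S) (E : Set S) : Prop where
  continuous : Continuous e
  range_eq : range e = E
  image_eq : e '' Icc 0 (2 * Real.pi) = E
  periodic : e 0 = e (2 * Real.pi)
  injOn : InjOn e (Ico 0 (2 * Real.pi))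

theorem IsCircle.exists_param {E : Set S} (hE : IsCircle E) : ∃ e, IsCircleParam e E := by
  obtain ⟨h⟩ := hE
  have hr : range (fun t ↦ (h.symm (Circle.exp t) : S)) = E := by
    ext x
    constructor
    · rintro ⟨t, rfl⟩; exact Subtype.coe_prop _
    · intro hx
      refine ⟨Complex.arg (h ⟨x, hx⟩), ?_⟩
      simp [Circle.exp_arg]
  have hp : Function.Periodic (fun t ↦ (h.symm (Circle.exp t) : S)) (2 * Real.pi) := fun t ↦ by
    simp
  refine ⟨fun t ↦ (h.symm (Circle.exp t) : S), by fun_prop, hr, ?_, ?_, ?_⟩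
  · refine Eq.trans ?_ hr
    simpa using hp.image_Icc Real.two_pi_pos 0
  · simp
  · intro s hs t ht hst
    have h1 : Circle.exp s = Circle.exp t := h.symm.injective (Subtype.ext hst)
    exact Circle.exp_injOn_Ico (by simp) hs ht h1

/-- The monodromy along `e` of the square root of `discQuot θ z w`. -/
noncomputable def discSign (θ : ℂ → S) (e : ℝ → S) (z w : ℂ) : ℂ :=
  sqrtRatio (fun t ↦ discQuot θ z w (e t)) 0 (2 * Real.pi)

variable {e : ℝ → S} {E : Set S}

theorem IsCircleParam.mem (he : IsCircleParam e E) (t : ℝ) : e t ∈ E :=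
  he.range_eq ▸ mem_range_self t

theorem IsCircleParam.isCompact (he : IsCircleParam e E) : IsCompact E :=
  he.image_eq ▸ isCompact_Icc.image he.continuous

theorem discSign_eq_one_of_sq (hθ : IsOpenEmbedding θ) (he : IsCircleParam e E) (hz : θ z ∉ E)
    (hw : θ w ∉ E) {s : S → ℂ} (hs : ∀ x ∈ E, ContinuousAt s x)
    (h : ∀ x ∈ E, s x ^ 2 = discQuot θ z w x) : discSign θ e z w = 1 := by
  have hne : ∀ {u : ℂ}, θ u ∉ E → ∀ t, e t ≠ θ u := fun hu t h ↦ hu (h ▸ he.mem t)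
  refine sqrtRatio_eq_one (s := fun t ↦ s (e t)) Real.two_pi_pos.le
    (fun t _ ↦ discQuot_ne_zero hθ (hne hz _) (hne hw _)) ?_ (fun t _ ↦ h _ (he.mem t))
    (by rw [he.periodic])
  exact fun t _ ↦ ((hs _ (he.mem t)).comp he.continuous.continuousAt).continuousWithinAt

variable [T2Space S]

theorem discQuot_comp_continuousOn (hθ : IsOpenEmbedding θ) (he : Continuous e) {T : Set ℝ}
    (hw : ∀ t ∈ T, e t ≠ θ w) : ContinuousOn (fun t ↦ discQuot θ z w (e t)) T := fun t ht ↦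
  (ContinuousAt.comp (g := discQuot θ z w) (discQuot_continuousAt hθ (hw t ht))
    he.continuousAt).continuousWithinAt

theorem discSign_mul (hθ : IsOpenEmbedding θ) (he : IsCircleParam e E) (hz : θ z ∉ E)
    (hw : θ w ∉ E) (hv : θ v ∉ E) :
    discSign θ e z w * discSign θ e w v = discSign θ e z v := by
  have hne : ∀ {u : ℂ}, θ u ∉ E → ∀ t, e t ≠ θ u := fun hu t h ↦ hu (h ▸ he.mem t)
  rw [discSign, discSign, ← sqrtRatio_mul Real.two_pi_pos.le]
  · congr 1
    ext t
    exact discQuot_mul hθ (hne hw t)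
  all_goals first
    | exact discQuot_comp_continuousOn hθ he.continuous (fun t _ ↦ hne (by assumption) t)
    | exact fun t _ ↦ discQuot_ne_zero hθ (hne (by assumption) t) (hne (by assumption) t)

theorem discSign_eq_or (hθ : IsOpenEmbedding θ) (he : IsCircleParam e E) (hz : θ z ∉ E)
    (hw : θ w ∉ E) : discSign θ e z w = 1 ∨ discSign θ e z w = -1 := by
  have hne : ∀ {u : ℂ}, θ u ∉ E → ∀ t, e t ≠ θ u := fun hu t h ↦ hu (h ▸ he.mem t)
  rw [← sq_eq_one_iff, discSign, sqrtRatio_sq Real.two_pi_pos.le, he.periodic, div_self]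
  · exact discQuot_ne_zero hθ (hne hz _) (hne hw _)
  · exact discQuot_comp_continuousOn hθ he.continuous (fun t _ ↦ hne (by assumption) t)
  · exact fun t _ ↦ discQuot_ne_zero hθ (hne (by assumption) t) (hne (by assumption) t)

theorem discSign_self (hθ : IsOpenEmbedding θ) (he : IsCircleParam e E) (hz : θ z ∉ E) :
    discSign θ e z z = 1 := by
  have h := discSign_mul hθ he hz hz hz
  rcases discSign_eq_or hθ he hz hz with h1 | h1
  · exact h1
  · rw [h1] at h; norm_num at h

theorem discSign_comm (hθ : IsOpenEmbedding θ) (he : IsCircleParam e E) (hz : θ z ∉ E)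
    (hw : θ w ∉ E) : discSign θ e z w = discSign θ e w z := by
  have h := discSign_mul hθ he hz hw hz
  rw [discSign_self hθ he hz] at h
  rcases discSign_eq_or hθ he hz hw with h1 | h1 <;> rw [h1] at h ⊢
  · simpa using h.symm
  · linear_combination h

theorem discSign_eq_one_of_near (hθ : IsOpenEmbedding θ) (he : IsCircleParam e E) {z₀ : ℂ} {r : ℝ}
    (hr : 0 < r) (hd : Disjoint (θ '' Metric.ball z₀ r) E) (hz : z ∈ Metric.ball z₀ (r / 3))
    (hw : w ∈ Metric.ball z₀ (r / 3)) : discSign θ e z w = 1 := by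
  have hsub : Metric.ball z₀ (r / 3) ⊆ Metric.ball z₀ r := Metric.ball_subset_ball (by linarith)
  have hz' : θ z ∉ E := disjoint_left.1 hd (mem_image_of_mem _ (hsub hz))
  have hw' : θ w ∉ E := disjoint_left.1 hd (mem_image_of_mem _ (hsub hw))
  have key : ∀ x ∈ E, discQuot θ z w x ∈ Complex.slitPlane := fun x hx ↦
    mem_slitPlane_of_norm_sub_one_lt
      (norm_discQuot_sub_one_lt hθ hr hz hw (disjoint_right.1 hd hx))
  refine discSign_eq_one_of_sq hθ he hz' hw' (s := fun x ↦ psqrt (discQuot θ z w x))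
    (fun x hx ↦ ?_) (fun x hx ↦ psqrt_sq (Complex.slitPlane_ne_zero (key x hx)))
  exact ContinuousAt.comp (g := psqrt) (psqrt_continuousAt (key x hx))
    (discQuot_continuousAt hθ fun h ↦ hw' (h ▸ hx))

end

/-- The difference quotient of an injective continuous map of the plane has a continuous
square root off the diagonal. -/
theorem exists_sqrt_diffQuot {ψ : ℂ → ℂ} (hψ : Continuous ψ) (hinj : Function.Injective ψ) :
    ∃ κ : ℂ × ℂ → ℂ, (∀ p : ℂ × ℂ, p.1 ≠ p.2 → ContinuousAt κ p) ∧
      ∀ p : ℂ × ℂ, p.1 ≠ p.2 → κ p ^ 2 = (ψ p.1 - ψ p.2) / (p.1 - p.2) := by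
  set K : ℂ × ℂ → ℂ := fun p ↦ (ψ (p.1 + Complex.exp p.2) - ψ (p.1 - Complex.exp p.2)) /
    (2 * Complex.exp p.2) with hK
  have hne : ∀ v, 2 * Complex.exp v ≠ 0 := fun v ↦ mul_ne_zero two_ne_zero (Complex.exp_ne_zero v)
  have hKc : Continuous K := by
    refine Continuous.div (by fun_prop) (by fun_prop) fun p ↦ hne _
  have hK0 : ∀ p, K p ≠ 0 := fun p ↦ by
    refine div_ne_zero (sub_ne_zero.2 fun h ↦ hne p.2 ?_) (hne _)
    linear_combination hinj h
  obtain ⟨s, hs, hsq⟩ := exists_continuous_sqrt hKc hK0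
  have hs0 : ∀ p, s p ≠ 0 := fun p h ↦ hK0 p (by rw [← hsq, h]; simp)
  have hKper : ∀ c v, K (c, v + Real.pi * Complex.I) = K (c, v) := fun c v ↦ by
    simp only [hK, Complex.exp_add, Complex.exp_pi_mul_I]
    rw [← neg_div_neg_eq]
    congr 1
    · rw [neg_sub]; congr 2 <;> ring
    · ring
  have hper : ∀ c v, s (c, v + 2 * Real.pi * Complex.I) = s (c, v) := by
    have h2 : ∀ c v, s (c, v + 2 * Real.pi * Complex.I) =
        s (c, (v + Real.pi * Complex.I) + Real.pi * Complex.I) := fun c v ↦ by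
      congr 2; ring
    have hs' : Continuous fun p : ℂ × ℂ ↦ s (p.1, p.2 + Real.pi * Complex.I) := by fun_prop
    rcases isPreconnected_univ.eq_or_eq_neg_of_sq_eq hs'.continuousOn hs.continuousOn
      (fun p _ ↦ by simp only [Pi.pow_apply, hsq]; exact hKper p.1 p.2)
      (fun {p} _ ↦ hs0 p) with h | h
    · have h1 : ∀ c v, s (c, v + Real.pi * Complex.I) = s (c, v) := fun c v ↦ h (mem_univ (c, v))
      intro c v
      rw [h2, h1, h1]
    · have h1 : ∀ c v, s (c, v + Real.pi * Complex.I) = - s (c, v) := fun c v ↦ h (mem_univ (c, v))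
      intro c v
      rw [h2, h1, h1, neg_neg]
  have hexp : ∀ c v v', Complex.exp v = Complex.exp v' → s (c, v) = s (c, v') := by
    intro c v v' h
    obtain ⟨n, hn⟩ := Complex.exp_eq_exp_iff_exists_int.1 h
    have hP : Function.Periodic (fun v ↦ s (c, v)) (2 * Real.pi * Complex.I) := hper c
    rw [hn]
    exact hP.int_mul n v'
  refine ⟨fun p ↦ s ((p.1 + p.2) / 2, Complex.log ((p.1 - p.2) / 2)), fun p hp ↦ ?_, fun p hp ↦ ?_⟩
  · have hp0 : (p.1 - p.2) / 2 ≠ 0 := div_ne_zero (sub_ne_zero.2 hp) two_ne_zero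
    by_cases hsl : (p.1 - p.2) / 2 ∈ Complex.slitPlane
    · have h1 : ContinuousAt (fun p : ℂ × ℂ ↦ Complex.log ((p.1 - p.2) / 2)) p :=
        ContinuousAt.clog (by fun_prop) hsl
      exact ContinuousAt.comp (g := s) hs.continuousAt (ContinuousAt.prodMk (by fun_prop) h1)
    · have hsl' : (p.2 - p.1) / 2 ∈ Complex.slitPlane := by
        rw [Complex.mem_slitPlane_iff] at hsl ⊢
        push Not at hsl
        have h1 : (p.2 - p.1) / 2 = -((p.1 - p.2) / 2) := by ring
        rw [h1, Complex.neg_re, Complex.neg_im]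
        left
        rcases hsl.1.lt_or_eq with h | h
        · linarith
        · exact absurd (Complex.ext h hsl.2) hp0
      have h1 : ContinuousAt (fun p : ℂ × ℂ ↦ Complex.log ((p.2 - p.1) / 2) +
          Real.pi * Complex.I) p := by
        have h0 : ContinuousAt (fun p : ℂ × ℂ ↦ Complex.log ((p.2 - p.1) / 2)) p :=
          ContinuousAt.clog (by fun_prop) hsl'
        exact h0.add continuousAt_const
      have h2 : ContinuousAt (fun p : ℂ × ℂ ↦ s ((p.1 + p.2) / 2,
          Complex.log ((p.2 - p.1) / 2) + Real.pi * Complex.I)) p :=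
        ContinuousAt.comp (g := s) hs.continuousAt (ContinuousAt.prodMk (by fun_prop) h1)
      refine h2.congr ?_
      have h3 : ∀ᶠ p : ℂ × ℂ in 𝓝 p, p.1 ≠ p.2 :=
        (isOpen_ne_fun continuous_fst continuous_snd).mem_nhds hp
      filter_upwards [h3] with q hq
      refine hexp _ _ _ ?_
      rw [Complex.exp_add, Complex.exp_pi_mul_I, Complex.exp_log, Complex.exp_log]
      · ring
      · exact div_ne_zero (sub_ne_zero.2 hq) two_ne_zero
      · exact div_ne_zero (sub_ne_zero.2 hq.symm) two_ne_zero
  · have hp0 : (p.1 - p.2) / 2 ≠ 0 := div_ne_zero (sub_ne_zero.2 hp) two_ne_zero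
    simp only [hsq, hK, Complex.exp_log hp0]
    congr 1
    · congr 2 <;> ring
    · ring

theorem div_mem_slitPlane_of_re_pos {a b : ℂ} (ha : 0 < a.re) (hb : 0 < b.re) :
    a / b ∈ Complex.slitPlane := by
  have hb0 : b ≠ 0 := fun h ↦ by simp [h] at hb
  rw [Complex.mem_slitPlane_iff]
  by_contra! h
  have h1 : a = (a / b) * b := by field_simp
  have h2 : a.re = (a / b).re * b.re := by
    conv_lhs => rw [h1, Complex.mul_re, h.2]
    ring
  nlinarith [h.1]

theorem re_pos_of_norm_sub_one_lt {a : ℂ} (h : ‖a - 1‖ < 1) : 0 < a.re := by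
  have h1 := (abs_le.1 (Complex.abs_re_le_norm (a - 1))).1
  simp only [Complex.sub_re, Complex.one_re] at h1
  linarith

/-- A smaller disc around any point of the plane. -/
theorem exists_openEmbedding_ball (z₀ : ℂ) {ε : ℝ} (hε : 0 < ε) :
    ∃ β : ℂ → ℂ, IsOpenEmbedding β ∧ β 0 = z₀ ∧ range β = Metric.ball z₀ ε := by
  refine ⟨OpenPartialHomeomorph.univBall z₀ ε,
    OpenPartialHomeomorph.isOpenEmbedding _ (OpenPartialHomeomorph.univBall_source z₀ ε),
    OpenPartialHomeomorph.univBall_apply_zero z₀ ε, ?_⟩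
  rw [← OpenPartialHomeomorph.univBall_target z₀ hε, ← image_univ,
    ← OpenPartialHomeomorph.univBall_source z₀ ε]
  exact (OpenPartialHomeomorph.univBall z₀ ε).image_source_eq_target

section

variable {S : Type*} [TopologicalSpace S] [T2Space S] {θ : ℂ → S} {ψ : ℂ → ℂ}

theorem exists_sqrt_discQuot_comp (hθ : IsOpenEmbedding θ) (hψ : IsOpenEmbedding ψ) :
    ∃ r > 0, ∀ z ∈ Metric.ball (0 : ℂ) r, ∀ w ∈ Metric.ball (0 : ℂ) r, ∃ σ : S → ℂ,
      ∀ q, q ≠ θ (ψ z) → q ≠ θ (ψ w) → ContinuousAt σ q ∧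
        discQuot θ (ψ z) (ψ w) q = σ q ^ 2 * discQuot (θ ∘ ψ) z w q := by
  have hθψ : IsOpenEmbedding (θ ∘ ψ) := hθ.comp hψ
  obtain ⟨κ, hκc, hκ⟩ := exists_sqrt_diffQuot hψ.continuous hψ.injective
  have hκ0 : ∀ ζ z : ℂ, ζ ≠ z → κ (ζ, z) ≠ 0 := fun ζ z h h' ↦ by
    have h1 := hκ (ζ, z) h
    rw [h', zero_pow two_ne_zero] at h1
    exact div_ne_zero (sub_ne_zero.2 (hψ.injective.ne h)) (sub_ne_zero.2 h) h1.symm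
  set k : Set ℂ := Metric.closedBall 0 2 \ Metric.ball 0 (1 / 2) with hk
  have hkc : IsCompact k := (isCompact_closedBall _ _).diff Metric.isOpen_ball
  have hk0 : ∀ ζ ∈ k, ζ ≠ 0 := fun ζ hζ h ↦ hζ.2 (by simp [h])
  have ev1 : ∀ᶠ p in 𝓝 ((0, 0) : ℂ × ℂ), ∀ ζ ∈ k, ‖κ (ζ, p.1) / κ (ζ, p.2) - 1‖ < 1 := by
    refine hkc.eventually_forall_of_forall_eventually fun ζ hζ ↦ ?_
    have h1 : ContinuousAt (fun x : (ℂ × ℂ) × ℂ ↦ κ (x.2, x.1.1)) ((0, 0), ζ) :=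
      ContinuousAt.comp (g := κ) (hκc (ζ, 0) (hk0 ζ hζ))
        (by fun_prop : ContinuousAt (fun x : (ℂ × ℂ) × ℂ ↦ (x.2, x.1.1)) ((0, 0), ζ))
    have h2 : ContinuousAt (fun x : (ℂ × ℂ) × ℂ ↦ κ (x.2, x.1.2)) ((0, 0), ζ) :=
      ContinuousAt.comp (g := κ) (hκc (ζ, 0) (hk0 ζ hζ))
        (by fun_prop : ContinuousAt (fun x : (ℂ × ℂ) × ℂ ↦ (x.2, x.1.2)) ((0, 0), ζ))
    have h3 : ContinuousAt (fun x : (ℂ × ℂ) × ℂ ↦ ‖κ (x.2, x.1.1) / κ (x.2, x.1.2) - 1‖)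
        ((0, 0), ζ) :=
      ((h1.div h2 (hκ0 ζ 0 (hk0 ζ hζ))).sub continuousAt_const).norm
    refine h3.eventually_lt continuousAt_const ?_
    simp [div_self (hκ0 ζ 0 (hk0 ζ hζ))]
  obtain ⟨ρ, hρ, hρs⟩ := Metric.isOpen_iff.1 (hψ.isOpenMap _ (Metric.isOpen_ball (x := (0 : ℂ))
    (ε := 1 / 2))) (ψ 0) (mem_image_of_mem _ (Metric.mem_ball_self (by norm_num)))
  have ev2 : ∀ᶠ z in 𝓝 (0 : ℂ), ψ z ∈ Metric.ball (ψ 0) (ρ / 3) :=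
    hψ.continuous.continuousAt.eventually (Metric.ball_mem_nhds _ (by positivity))
  have ev3 : ∀ᶠ z in 𝓝 (0 : ℂ), z ∈ Metric.ball (0 : ℂ) (1 / 2 / 3) :=
    Metric.ball_mem_nhds _ (by norm_num)
  rw [nhds_prod_eq] at ev1
  obtain ⟨p1, hp1, p2, hp2, hp⟩ := Filter.eventually_prod_iff.1 ev1
  obtain ⟨r, hr, hrs⟩ := Metric.eventually_nhds_iff_ball.1 (((ev2.and ev3).and hp1).and hp2)
  refine ⟨r, hr, fun z hz w hw ↦ ?_⟩
  obtain ⟨⟨⟨hz2, hz3⟩, hz4⟩, -⟩ := hrs z hz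
  obtain ⟨⟨⟨hw2, hw3⟩, -⟩, hw4⟩ := hrs w hw
  have hκ1 : ∀ ζ ∈ k, ‖κ (ζ, z) / κ (ζ, w) - 1‖ < 1 := hp hz4 hw4
  set A : S → ℂ := discQuot θ (ψ z) (ψ w) with hA
  set B : S → ℂ := discQuot (θ ∘ ψ) z w with hB
  set O : Set S := (θ ∘ ψ) '' Metric.ball 0 2 with hO
  set F : Set S := (θ ∘ ψ) '' Metric.closedBall 0 (1 / 2) with hF
  have hOo : IsOpen O := hθψ.isOpenMap _ Metric.isOpen_ball
  have hFc : IsClosed F := ((isCompact_closedBall _ _).image hθψ.continuous).isClosed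
  have hFO : F ⊆ O := image_mono (Metric.closedBall_subset_ball (by norm_num))
  have hfar : ∀ q ∉ F, 0 < (A q).re ∧ 0 < (B q).re := by
    intro q hq
    constructor
    · refine re_pos_of_norm_sub_one_lt (norm_discQuot_sub_one_lt hθ hρ hz2 hw2 fun h ↦ hq ?_)
      obtain ⟨ζ, hζ, rfl⟩ := h
      obtain ⟨ξ, hξ, rfl⟩ := hρs hζ
      exact ⟨ξ, Metric.ball_subset_closedBall hξ, rfl⟩
    · refine re_pos_of_norm_sub_one_lt
        (norm_discQuot_sub_one_lt hθψ (by norm_num) hz3 hw3 fun h ↦ hq ?_)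
      exact image_mono Metric.ball_subset_closedBall h
  set c : S → ℂ := Function.invFun (θ ∘ ψ) with hc
  have hcθ : ∀ ζ, c (θ (ψ ζ)) = ζ := Function.leftInverse_invFun hθψ.injective
  set f : S → ℂ := fun q ↦ κ (c q, z) / κ (c q, w) with hf
  have hfsq : ∀ q ∈ O, q ≠ θ (ψ z) → q ≠ θ (ψ w) → A q = f q ^ 2 * B q := by
    rintro _ ⟨ζ, -, rfl⟩ hqz hqw
    have hζz : ζ ≠ z := fun h ↦ hqz (by rw [h]; rfl)
    have hζw : ζ ≠ w := fun h ↦ hqw (by rw [h]; rfl)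
    have e1 : A ((θ ∘ ψ) ζ) = (ψ ζ - ψ z) / (ψ ζ - ψ w) := discQuot_apply hθ _ _ _
    have e2 : B ((θ ∘ ψ) ζ) = (ζ - z) / (ζ - w) := discQuot_apply hθψ _ _ _
    have e3 : f ((θ ∘ ψ) ζ) = κ (ζ, z) / κ (ζ, w) := by
      simp only [hf, Function.comp_apply, hcθ]
    rw [e1, e2, e3, div_pow, hκ (ζ, z) hζz, hκ (ζ, w) hζw]
    have n1 := sub_ne_zero.2 hζz
    have n2 := sub_ne_zero.2 hζw
    have n3 := sub_ne_zero.2 (hψ.injective.ne hζw)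
    field_simp
  classical
  set σ : S → ℂ := fun q ↦ if q ∈ F then f q else psqrt (A q / B q) with hσ
  have hσO : ∀ q ∈ O, q ≠ θ (ψ z) → q ≠ θ (ψ w) → σ q = f q := by
    intro q hqO hqz hqw
    by_cases hq : q ∈ F
    · simp [hσ, hq]
    · simp only [hσ, hq, if_false]
      obtain ⟨h1, h2⟩ := hfar q hq
      have hsl := div_mem_slitPlane_of_re_pos h1 h2
      have hB0 : B q ≠ 0 := fun h ↦ by simp [h] at h2
      refine eq_of_sq_eq_of_re_pos ?_ (psqrt_re_pos hsl) (re_pos_of_norm_sub_one_lt ?_)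
      · rw [psqrt_sq (Complex.slitPlane_ne_zero hsl), hfsq q hqO hqz hqw]
        field_simp
      · obtain ⟨ζ, hζ, rfl⟩ := hqO
        have hζk : ζ ∈ k := ⟨Metric.ball_subset_closedBall hζ, fun h ↦
          hq ⟨ζ, Metric.ball_subset_closedBall h, rfl⟩⟩
        simp only [hf, Function.comp_apply, hcθ]
        exact hκ1 ζ hζk
  refine ⟨σ, fun q hqz hqw ↦ ⟨?_, ?_⟩⟩
  · by_cases hq : q ∈ F
    · have hqO := hFO hq
      have hfq : ContinuousAt f q := by
        obtain ⟨ζ, hζ, rfl⟩ := hqO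
        have hζz : ζ ≠ z := fun h ↦ hqz (by rw [h]; rfl)
        have hζw : ζ ≠ w := fun h ↦ hqw (by rw [h]; rfl)
        rw [← hθψ.continuousAt_iff]
        have : f ∘ (θ ∘ ψ) = fun ζ ↦ κ (ζ, z) / κ (ζ, w) := by
          ext ζ; simp only [hf, Function.comp_apply, hcθ]
        rw [this]
        have c1 : ContinuousAt (fun ζ ↦ κ (ζ, z)) ζ :=
          ContinuousAt.comp (f := fun ζ : ℂ ↦ (ζ, z)) (hκc (ζ, z) hζz) (by fun_prop)
        have c2 : ContinuousAt (fun ζ ↦ κ (ζ, w)) ζ :=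
          ContinuousAt.comp (f := fun ζ : ℂ ↦ (ζ, w)) (hκc (ζ, w) hζw) (by fun_prop)
        exact c1.div c2 (hκ0 _ _ hζw)
      refine hfq.congr ?_
      filter_upwards [hOo.mem_nhds hqO, isOpen_ne.mem_nhds hqz, isOpen_ne.mem_nhds hqw]
        with p h1 h2 h3 using (hσO p h1 h2 h3).symm
    · obtain ⟨h1, h2⟩ := hfar q hq
      have hsl := div_mem_slitPlane_of_re_pos h1 h2
      have hB0 : B q ≠ 0 := fun h ↦ by simp [h] at h2
      have h3 : ContinuousAt (fun q ↦ psqrt (A q / B q)) q :=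
        ContinuousAt.comp (g := psqrt) (psqrt_continuousAt hsl)
          ((discQuot_continuousAt hθ hqw).div (discQuot_continuousAt hθψ hqw) hB0)
      refine h3.congr ?_
      filter_upwards [hFc.isOpen_compl.mem_nhds hq] with p hp
      simp only [hσ]
      rw [if_neg hp]
  · by_cases hq : q ∈ F
    · rw [hσO q (hFO hq) hqz hqw]
      exact hfsq q (hFO hq) hqz hqw
    · simp only [hσ, hq, if_false]
      obtain ⟨h1, h2⟩ := hfar q hq
      have hB0 : B q ≠ 0 := fun h ↦ by simp [h] at h2
      rw [psqrt_sq (Complex.slitPlane_ne_zero (div_mem_slitPlane_of_re_pos h1 h2)),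
        div_mul_cancel₀ _ hB0]

theorem exists_discSign_comp_eq (hθ : IsOpenEmbedding θ) (hψ : IsOpenEmbedding ψ) :
    ∃ r > 0, ∀ z ∈ Metric.ball (0 : ℂ) r, ∀ w ∈ Metric.ball (0 : ℂ) r,
      ∀ (e : ℝ → S) (E : Set S), IsCircleParam e E → θ (ψ z) ∉ E → θ (ψ w) ∉ E →
        discSign θ e (ψ z) (ψ w) = discSign (θ ∘ ψ) e z w := by
  have hθψ : IsOpenEmbedding (θ ∘ ψ) := hθ.comp hψ
  obtain ⟨r, hr, H⟩ := exists_sqrt_discQuot_comp hθ hψ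
  refine ⟨r, hr, fun z hz w hw e E he hzE hwE ↦ ?_⟩
  obtain ⟨σ, hσ⟩ := H z hz w hw
  have hnz : ∀ t, e t ≠ θ (ψ z) := fun t h ↦ hzE (h ▸ he.mem t)
  have hnw : ∀ t, e t ≠ θ (ψ w) := fun t h ↦ hwE (h ▸ he.mem t)
  have hσe : Continuous fun t ↦ σ (e t) := continuous_iff_continuousAt.2 fun t ↦
    ContinuousAt.comp (g := σ) (hσ _ (hnz t) (hnw t)).1 he.continuous.continuousAt
  have hσ0 : ∀ t, σ (e t) ^ 2 ≠ 0 := fun t h ↦ by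
    have h1 := (hσ _ (hnz t) (hnw t)).2
    rw [h, zero_mul] at h1
    exact discQuot_ne_zero hθ (hnz t) (hnw t) h1
  have h1 : sqrtRatio (fun t ↦ σ (e t) ^ 2) 0 (2 * Real.pi) = 1 :=
    sqrtRatio_eq_one (s := fun t ↦ σ (e t)) Real.two_pi_pos.le (fun t _ ↦ hσ0 t)
      hσe.continuousOn (fun _ _ ↦ rfl) (by rw [he.periodic])
  have h2 : (fun t ↦ discQuot θ (ψ z) (ψ w) (e t)) =
      fun t ↦ σ (e t) ^ 2 * discQuot (θ ∘ ψ) z w (e t) := by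
    ext t; exact (hσ _ (hnz t) (hnw t)).2
  rw [discSign, h2, sqrtRatio_mul (u := fun t ↦ σ (e t) ^ 2) Real.two_pi_pos.le (hσe.pow 2).continuousOn
    (discQuot_comp_continuousOn hθψ he.continuous fun t _ ↦ hnw t) (fun t _ ↦ hσ0 t)
    (fun t _ ↦ discQuot_ne_zero hθψ (hnz t) (hnw t)), h1, one_mul, discSign]

/-- Near a common point of two discs, the signs computed in the two discs agree. -/
theorem exists_nhds_discSign_eq {θ' : ℂ → S} (hθ : IsOpenEmbedding θ) (hθ' : IsOpenEmbedding θ')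
    {x : S} (hx : x ∈ range θ) (hx' : x ∈ range θ') :
    ∃ W, IsOpen W ∧ x ∈ W ∧ ∀ z w z' w', θ z = θ' z' → θ w = θ' w' → θ z ∈ W → θ w ∈ W →
      ∀ (e : ℝ → S) (E : Set S), IsCircleParam e E → θ z ∉ E → θ w ∉ E →
        discSign θ e z w = discSign θ' e z' w' := by
  obtain ⟨z₀, rfl⟩ := hx
  have hpre : IsOpen (θ ⁻¹' range θ') := hθ'.isOpen_range.preimage hθ.continuous
  obtain ⟨ε, hε, hεs⟩ := Metric.isOpen_iff.1 hpre z₀ hx'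
  obtain ⟨β, hβ, hβ0, hβr⟩ := exists_openEmbedding_ball z₀ hε
  have hlift : ∀ ζ, ∃ ξ, θ' ξ = θ (β ζ) := fun ζ ↦ hεs (hβr ▸ mem_range_self ζ)
  choose ψ hψ using hlift
  have hcomp : θ' ∘ ψ = θ ∘ β := funext hψ
  have hψo : IsOpenEmbedding ψ := IsOpenEmbedding.of_comp ψ hθ' (hcomp ▸ hθ.comp hβ)
  obtain ⟨r, hr, H⟩ := exists_discSign_comp_eq hθ hβ
  obtain ⟨r', hr', H'⟩ := exists_discSign_comp_eq hθ' hψo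
  refine ⟨(θ ∘ β) '' Metric.ball 0 (min r r'), (hθ.comp hβ).isOpenMap _ Metric.isOpen_ball,
    ⟨0, Metric.mem_ball_self (lt_min hr hr'), by simp [hβ0]⟩, ?_⟩
  rintro z w z' w' hz hw ⟨ζ, hζ, hζz⟩ ⟨ξ, hξ, hξw⟩ e E he hzE hwE
  have e1 : z = β ζ := hθ.injective hζz.symm
  have e2 : w = β ξ := hθ.injective hξw.symm
  have e3 : z' = ψ ζ := hθ'.injective (by rw [← hz, ← hζz, hψ]; rfl)
  have e4 : w' = ψ ξ := hθ'.injective (by rw [← hw, ← hξw, hψ]; rfl)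
  have b1 := Metric.ball_subset_ball (min_le_left r r') hζ
  have b2 := Metric.ball_subset_ball (min_le_left r r') hξ
  have b3 := Metric.ball_subset_ball (min_le_right r r') hζ
  have b4 := Metric.ball_subset_ball (min_le_right r r') hξ
  subst e1 e2 e3 e4
  rw [H ζ b1 ξ b2 e E he hzE hwE, H' ζ b3 ξ b4 e E he (hz ▸ hzE) (hw ▸ hwE), hcomp]

end

/-- A function that is locally constant off a set with dense complement is constant off it. -/
theorem IsPreconnected.eq_of_locally_eq_on_dense {X α : Type*} [TopologicalSpace X] {M A : Set X}
    (hM : IsPreconnected M) (hA : Dense A) (f : X → α)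
    (h : ∀ x ∈ M, ∃ W, IsOpen W ∧ x ∈ W ∧ ∀ p ∈ W ∩ A, ∀ q ∈ W ∩ A, f p = f q) {p q : X}
    (hp : p ∈ M ∩ A) (hq : q ∈ M ∩ A) : f p = f q := by
  set U : Set X := ⋃₀ {W | IsOpen W ∧ ∀ x ∈ W ∩ A, f x = f p} with hU
  set V : Set X := ⋃₀ {W | IsOpen W ∧ ∀ x ∈ W ∩ A, f x ≠ f p} with hV
  by_contra hne
  have hUo : IsOpen U := isOpen_sUnion fun W hW ↦ hW.1
  have hVo : IsOpen V := isOpen_sUnion fun W hW ↦ hW.1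
  have hcov : M ⊆ U ∪ V := fun x hx ↦ by
    obtain ⟨W, hW, hxW, hWf⟩ := h x hx
    by_cases hex : ∃ y ∈ W ∩ A, f y = f p
    · obtain ⟨y, hy, hyp⟩ := hex
      exact Or.inl ⟨W, ⟨hW, fun z hz ↦ (hWf z hz y hy).trans hyp⟩, hxW⟩
    · push Not at hex
      exact Or.inr ⟨W, ⟨hW, hex⟩, hxW⟩
  have hpU : p ∈ U := by
    obtain ⟨W, hW, hxW, hWf⟩ := h p hp.1
    exact ⟨W, ⟨hW, fun z hz ↦ hWf z hz p ⟨hxW, hp.2⟩⟩, hxW⟩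
  have hqV : q ∈ V := by
    obtain ⟨W, hW, hxW, hWf⟩ := h q hq.1
    exact ⟨W, ⟨hW, fun z hz hzp ↦ hne ((hWf q ⟨hxW, hq.2⟩ z hz).trans hzp).symm⟩, hxW⟩
  obtain ⟨x, -, ⟨W₁, hW₁, hx₁⟩, ⟨W₂, hW₂, hx₂⟩⟩ :=
    hM U V hUo hVo hcov ⟨p, hp.1, hpU⟩ ⟨q, hq.1, hqV⟩
  obtain ⟨y, hy, hyA⟩ := hA.inter_open_nonempty _ (hW₁.1.inter hW₂.1) ⟨x, hx₁, hx₂⟩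
  exact hW₂.2 y ⟨hy.2, hyA⟩ (hW₁.2 y ⟨hy.1, hyA⟩)

theorem not_injective_of_continuous_real {g : ℂ → ℝ} (hg : Continuous g) :
    ¬ Function.Injective g := by
  intro hinj
  have key : ∀ a b c, g a < g b → g b < g c → False := by
    intro a b c hab hbc
    have hcon : IsConnected ({b}ᶜ : Set ℂ) :=
      isConnected_compl_singleton_of_one_lt_rank (by simp [Complex.rank_real_complex]) b
    have h1 := hcon.isPreconnected.image g hg.continuousOn
    have ha : a ∈ ({b}ᶜ : Set ℂ) := fun h ↦ by simp at h; simp [h] at hab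
    have hc : c ∈ ({b}ᶜ : Set ℂ) := fun h ↦ by simp at h; simp [h] at hbc
    obtain ⟨x, hx, hxb⟩ := h1.Icc_subset (mem_image_of_mem g ha) (mem_image_of_mem g hc)
      ⟨hab.le, hbc.le⟩
    exact hx (hinj hxb)
  have h01 := hinj.ne (zero_ne_one : (0 : ℂ) ≠ 1)
  have h02 := hinj.ne (two_ne_zero : (2 : ℂ) ≠ 0)
  have h12 := hinj.ne (by norm_num : (1 : ℂ) ≠ 2)
  rcases lt_or_gt_of_ne h01 with a | a <;> rcases lt_or_gt_of_ne h02 with b | b <;>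
    rcases lt_or_gt_of_ne h12 with c | c
  · exact key _ _ _ b a |>.elim
  · exact key _ _ _ b a |>.elim
  · exact key _ _ _ a c
  · exact key _ _ _ b c
  · exact key _ _ _ c b
  · exact key _ _ _ c a
  · exact key _ _ _ a b
  · exact key _ _ _ a b

theorem IsCircle.not_range_subset {S : Type*} [TopologicalSpace S] {E : Set S} (hE : IsCircle E)
    {θ : ℂ → S} (hθ : IsOpenEmbedding θ) : ¬ range θ ⊆ E := by
  intro hsub
  obtain ⟨h⟩ := hE
  set f : ℂ → Circle := fun z ↦ h ⟨θ z, hsub (mem_range_self z)⟩ with hf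
  have hfc : Continuous f := h.continuous.comp (hθ.continuous.subtype_mk _)
  have hfi : Function.Injective f := fun z w hzw ↦
    hθ.injective (congrArg Subtype.val (h.injective hzw))
  have hc : IsSimplyConnected (univ : Set ℂ) := by
    have : ContractibleSpace (univ : Set ℂ) :=
      (Homeomorph.Set.univ ℂ).contractibleSpace
    exact SimplyConnectedSpace.ofContractible _
  obtain ⟨L, hLc, hL⟩ := Complex.exists_continuousOn_eqOn_exp_comp (g := fun z ↦ (f z : ℂ)) hc
    isOpen_univ (by fun_prop) (by rintro ⟨z, -, hz⟩; exact Circle.coe_ne_zero _ hz)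
  refine not_injective_of_continuous_real (g := fun z ↦ (L z).im)
    (Complex.continuous_im.comp (continuousOn_univ.1 hLc)) fun z w hzw ↦ hfi ?_
  have hre : ∀ z, (L z).re = 0 := fun z ↦ by
    have h1 : Complex.exp (L z) = f z := hL (mem_univ z)
    have h2 := Complex.norm_exp (L z)
    rw [h1, Circle.norm_coe] at h2
    exact (Real.exp_eq_one_iff _).1 h2.symm
  have hLzw : L z = L w := Complex.ext (by rw [hre, hre]) hzw
  have h1 : Complex.exp (L z) = f z := hL (mem_univ z)
  have h2 : Complex.exp (L w) = f w := hL (mem_univ w)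
  exact Circle.ext (by rw [← h1, ← h2, hLzw])

theorem IsCircle.dense_preimage_compl {S : Type*} [TopologicalSpace S] {E : Set S}
    (hE : IsCircle E) {θ : ℂ → S} (hθ : IsOpenEmbedding θ) : Dense {z | θ z ∉ E} := by
  rw [Metric.dense_iff]
  intro z r hr
  obtain ⟨β, hβ, -, hβr⟩ := exists_openEmbedding_ball z hr
  obtain ⟨_, ⟨ζ, rfl⟩, hζ⟩ := not_subset.1 (hE.not_range_subset (hθ.comp hβ))
  exact ⟨β ζ, hβr ▸ mem_range_self ζ, hζ⟩

/-- There is no continuous square root of `(Q - z) / (P - z)` off `P` and `Q`. -/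
theorem not_exists_sqrt_moebius {P Q C : ℂ} (hPQ : P ≠ Q) (hC : C ≠ 0) {M : ℂ → ℂ}
    (hM : ∀ z, z ≠ P → z ≠ Q → ContinuousAt M z)
    (hsq : ∀ z, z ≠ P → z ≠ Q → M z ^ 2 = C * ((Q - z) / (P - z))) : False := by
  set δ : ℂ := (Q - P) / 2 with hδ
  have hQP : Q - P ≠ 0 := sub_ne_zero.2 hPQ.symm
  have hδ0 : δ ≠ 0 := div_ne_zero hQP two_ne_zero
  set z : ℝ → ℂ := fun τ ↦ P + δ * Complex.exp (τ * Complex.I) with hz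
  have hzc : Continuous z := by fun_prop
  have hsl : ∀ τ, (Q - z τ) / (Q - P) ∈ Complex.slitPlane := by
    intro τ
    refine mem_slitPlane_of_norm_sub_one_lt ?_
    have : (Q - z τ) / (Q - P) - 1 = - (1 / 2) * Complex.exp (τ * Complex.I) := by
      simp only [hz, hδ]; field_simp; ring
    rw [this, norm_mul, Complex.norm_exp_ofReal_mul_I]
    norm_num
  have hzP : ∀ τ, z τ ≠ P := fun τ h ↦ by
    have : δ * Complex.exp (τ * Complex.I) = 0 := by linear_combination h
    exact mul_ne_zero hδ0 (Complex.exp_ne_zero _) this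
  have hzQ : ∀ τ, z τ ≠ Q := fun τ h ↦ by
    have := Complex.slitPlane_ne_zero (hsl τ)
    rw [h] at this; simp at this
  have hM0 : ∀ τ, M (z τ) ≠ 0 := fun τ h ↦ by
    have h1 := hsq _ (hzP τ) (hzQ τ)
    rw [h, zero_pow two_ne_zero] at h1
    exact mul_ne_zero hC (div_ne_zero (sub_ne_zero.2 (hzQ τ).symm) (sub_ne_zero.2 (hzP τ).symm))
      h1.symm
  set D : ℂ := psqrt (- 2 * C) with hD
  have hD2 : D ^ 2 = - 2 * C := psqrt_sq (mul_ne_zero (by norm_num) hC)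
  have hexp0 : ∀ x ∈ Icc (0 : ℝ) (2 * Real.pi), Complex.exp (x * Complex.I) ≠ 0 :=
    fun x _ ↦ Complex.exp_ne_zero _
  have h1 : sqrtRatio (fun τ ↦ Complex.exp (τ * Complex.I)) 0 (2 * Real.pi) = 1 := by
    refine sqrtRatio_eq_one (s := fun τ ↦ D * psqrt ((Q - z τ) / (Q - P)) / M (z τ))
      Real.two_pi_pos.le hexp0 ?_ ?_ ?_
    · intro τ _
      have c1 : ContinuousAt (fun τ ↦ psqrt ((Q - z τ) / (Q - P))) τ :=
        ContinuousAt.comp (g := psqrt) (psqrt_continuousAt (hsl τ)) (by fun_prop)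
      have c2 : ContinuousAt (fun τ ↦ M (z τ)) τ :=
        ContinuousAt.comp (g := M) (hM _ (hzP τ) (hzQ τ)) hzc.continuousAt
      exact ((continuousAt_const.mul c1).div c2 (hM0 τ)).continuousWithinAt
    · intro τ _
      rw [div_pow, mul_pow, psqrt_sq (Complex.slitPlane_ne_zero (hsl τ)), hD2,
        hsq _ (hzP τ) (hzQ τ)]
      have n1 : Q - z τ ≠ 0 := sub_ne_zero.2 (hzQ τ).symm
      have n2 : P - z τ ≠ 0 := sub_ne_zero.2 (hzP τ).symm
      field_simp
      simp only [hz, hδ]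
      ring
    · have : z 0 = z (2 * Real.pi) := by
        simp [hz, Complex.exp_two_pi_mul_I]
      simp only [this]
  have h2 : sqrtRatio (fun τ ↦ Complex.exp (τ * Complex.I)) 0 (2 * Real.pi) = -1 := by
    rw [sqrtRatio_eq (s := fun τ ↦ Complex.exp (τ / 2 * Complex.I)) Real.two_pi_pos.le hexp0
      (by fun_prop) ?_]
    · have : ((2 * Real.pi : ℝ) : ℂ) / 2 * Complex.I = Real.pi * Complex.I := by push_cast; ring
      simp only [this, Complex.exp_pi_mul_I]
      simp
    · intro τ _
      rw [← Complex.exp_nat_mul]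
      congr 1; push_cast; ring
  rw [h1] at h2
  norm_num at h2

section

variable {S : Type*} [TopologicalSpace S] [T2Space S] {θ : ℂ → S} {e : ℝ → S} {E : Set S}

theorem sqrtRatio_discQuot_continuousAt (hθ : IsOpenEmbedding θ) (he : Continuous e) {a b : ℝ}
    (hab : a ≤ b) {z₀ v : ℂ} (hz : θ z₀ ∉ e '' Icc a b) (hv : θ v ∉ e '' Icc a b) :
    ContinuousAt (fun z ↦ sqrtRatio (fun t ↦ discQuot θ z v (e t)) a b) z₀ := by
  have hT : IsClosed (e '' Icc a b) := (isCompact_Icc.image he).isClosed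
  obtain ⟨r, hr, hrs⟩ := Metric.isOpen_iff.1 (hT.isOpen_compl.preimage hθ.continuous) z₀ hz
  have hsub : Metric.ball z₀ (r / 3) ⊆ Metric.ball z₀ r := Metric.ball_subset_ball (by linarith)
  have hne : ∀ {u}, θ u ∉ e '' Icc a b → ∀ t ∈ Icc a b, e t ≠ θ u := fun hu t ht h ↦
    hu ⟨t, ht, h⟩
  have hslit : ∀ z ∈ Metric.ball z₀ (r / 3), ∀ t ∈ Icc a b,
      discQuot θ z z₀ (e t) ∈ Complex.slitPlane := by
    intro z hz t ht
    refine mem_slitPlane_of_norm_sub_one_lt (norm_discQuot_sub_one_lt hθ hr hz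
      (Metric.mem_ball_self (by positivity)) ?_)
    rintro ⟨ζ, hζ, h⟩
    exact hrs hζ ⟨t, ht, h.symm⟩
  have hq : ∀ t ∈ Icc a b, ContinuousAt (fun z ↦ psqrt (discQuot θ z z₀ (e t))) z₀ := by
    intro t ht
    refine ContinuousAt.comp (g := psqrt) (f := fun z ↦ discQuot θ z z₀ (e t))
      (psqrt_continuousAt (hslit _ (Metric.mem_ball_self (by positivity)) t ht)) ?_
    by_cases h : e t ∈ range θ
    · obtain ⟨ζ, hζ⟩ := h
      simp only [← hζ, discQuot_apply hθ]
      fun_prop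
    · simp only [discQuot_of_notMem h]
      exact continuousAt_const
  have hc := (continuousAt_const (y := sqrtRatio (fun t ↦ discQuot θ z₀ v (e t)) a b)).mul
    ((hq b (right_mem_Icc.2 hab)).div (hq a (left_mem_Icc.2 hab)) (psqrt_ne_zero _))
  refine hc.congr ?_
  filter_upwards [Metric.ball_mem_nhds z₀ (by positivity : 0 < r / 3)] with z hzr
  have hz' : θ z ∉ e '' Icc a b := hrs (hsub hzr)
  have hcont : ∀ {u w}, θ w ∉ e '' Icc a b →
      ContinuousOn (fun t ↦ discQuot θ u w (e t)) (Icc a b) := fun hw ↦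
    discQuot_comp_continuousOn hθ he (hne hw)
  have hn0 : ∀ {u w}, θ u ∉ e '' Icc a b → θ w ∉ e '' Icc a b →
      ∀ t ∈ Icc a b, discQuot θ u w (e t) ≠ 0 := fun hu hw t ht ↦
    discQuot_ne_zero hθ (hne hu t ht) (hne hw t ht)
  simp only [Pi.mul_apply, Pi.div_apply]
  rw [← sqrtRatio_eq_psqrt hab (u := fun t ↦ discQuot θ z z₀ (e t)) (hcont hz)
    (hslit z hzr), mul_comm,
    ← sqrtRatio_mul hab (hcont hz) (hcont hv) (hn0 hz' hz) (hn0 hz hv)]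
  refine sqrtRatio_congr hab ((hcont hz).mul (hcont hv))
    (fun t ht ↦ mul_ne_zero (hn0 hz' hz t ht) (hn0 hz hv t ht)) fun t ht ↦ ?_
  exact discQuot_mul hθ (hne hz t ht)

/-- If all signs in a disc were trivial, the disc would miss the circle. -/
theorem exists_discSign_ne_one (hθ : IsOpenEmbedding θ) (hE : IsCircle E) (he : IsCircleParam e E)
    (hmeet : (E ∩ range θ).Nonempty) :
    ∃ z w, θ z ∉ E ∧ θ w ∉ E ∧ discSign θ e z w ≠ 1 := by
  by_contra! hone
  obtain ⟨v, hv⟩ := (hE.dense_preimage_compl hθ).nonempty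
  have hv : θ v ∉ E := hv
  have h2π := Real.two_pi_pos
  have hopen : IsOpen (e ⁻¹' range θ) := hθ.isOpen_range.preimage he.continuous
  obtain ⟨s, t, hs0, hst, ht1, hsθ, htθ⟩ : ∃ s t, 0 < s ∧ s < t ∧ t < 2 * Real.pi ∧
      e s ∈ range θ ∧ e t ∈ range θ := by
    obtain ⟨x, hxE, hxθ⟩ := hmeet
    rw [← he.image_eq] at hxE
    obtain ⟨τ, hτ, rfl⟩ := hxE
    rw [← closure_Ioo h2π.ne] at hτ
    obtain ⟨s, hsθ, hs⟩ := mem_closure_iff.1 hτ _ hopen hxθ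
    have hnh : e ⁻¹' range θ ∩ Ioo 0 (2 * Real.pi) ∈ 𝓝 s :=
      (hopen.inter isOpen_Ioo).mem_nhds ⟨hsθ, hs⟩
    obtain ⟨t, ht, hst⟩ := ((mem_nhdsWithin_of_mem_nhds hnh : _ ∈ 𝓝[>] s)
      |> fun h ↦ Filter.nonempty_of_mem (Filter.inter_mem h self_mem_nhdsWithin))
    exact ⟨s, t, hs.1, hst, ht.2.2, hsθ, ht.1⟩
  obtain ⟨P, hP⟩ := hsθ
  obtain ⟨Q, hQ⟩ := htθ
  have hPQ : P ≠ Q := by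
    intro h
    refine hst.ne (he.injOn ⟨hs0.le, hst.trans ht1⟩ ⟨(hs0.trans hst).le, ht1⟩ ?_)
    rw [← hP, ← hQ, h]
  have hsubE : ∀ {a b : ℝ}, e '' Icc a b ⊆ E := by
    rintro a b _ ⟨τ, -, rfl⟩; exact he.mem τ
  have hvT : ∀ {a b : ℝ}, θ v ∉ e '' Icc a b := fun h ↦ hv (hsubE h)
  set m : ℝ → ℝ → ℂ → ℂ := fun a b z ↦ sqrtRatio (fun t ↦ discQuot θ z v (e t)) a b with hm
  have hne : ∀ {u : ℂ} {a b : ℝ}, θ u ∉ e '' Icc a b → ∀ t ∈ Icc a b, e t ≠ θ u :=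
    fun hu t ht h ↦ hu ⟨t, ht, h⟩
  have hcont : ∀ {a b : ℝ} (z : ℂ), ContinuousOn (fun t ↦ discQuot θ z v (e t)) (Icc a b) :=
    fun z ↦ discQuot_comp_continuousOn hθ he.continuous (hne hvT)
  have hn0 : ∀ {a b : ℝ} {z : ℂ}, θ z ∉ e '' Icc a b →
      ∀ t ∈ Icc a b, discQuot θ z v (e t) ≠ 0 := fun hz t ht ↦
    discQuot_ne_zero hθ (hne hz t ht) (hne hvT t ht)
  set A₁ := e '' Icc s t with hA₁
  set A₂ := e '' Icc 0 s with hA₂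
  set A₃ := e '' Icc t (2 * Real.pi) with hA₃
  have hEU : ∀ x ∈ E, x ∈ A₁ ∨ x ∈ A₂ ∨ x ∈ A₃ := by
    intro x hx
    rw [← he.image_eq] at hx
    obtain ⟨τ, hτ, rfl⟩ := hx
    rcases le_total τ s with h | h
    · exact Or.inr (Or.inl ⟨τ, ⟨hτ.1, h⟩, rfl⟩)
    · rcases le_total τ t with h' | h'
      · exact Or.inl ⟨τ, ⟨h, h'⟩, rfl⟩
      · exact Or.inr (Or.inr ⟨τ, ⟨h', hτ.2⟩, rfl⟩)
  have hmem : ∀ τ ∈ Icc s t, τ ∈ Ico 0 (2 * Real.pi) := fun τ hτ ↦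
    ⟨hs0.le.trans hτ.1, hτ.2.trans_lt ht1⟩
  have hdisj : ∀ z, θ z ∈ A₁ → z ≠ P → z ≠ Q → θ z ∉ A₂ ∧ θ z ∉ A₃ := by
    rintro z ⟨τ, hτ, hτz⟩ hzP hzQ
    have hτs : τ ≠ s := fun h ↦ hzP (hθ.injective (by rw [← hτz, h, hP]))
    have hτt : τ ≠ t := fun h ↦ hzQ (hθ.injective (by rw [← hτz, h, hQ]))
    have l1 := lt_of_le_of_ne hτ.1 (Ne.symm hτs)
    have l2 := lt_of_le_of_ne hτ.2 hτt
    constructor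
    · rintro ⟨τ', hτ', h⟩
      have := he.injOn (hmem τ hτ) ⟨hτ'.1, hτ'.2.trans_lt (hst.trans ht1)⟩ (hτz.trans h.symm)
      linarith [hτ'.2]
    · rintro ⟨τ', hτ', h⟩
      rcases hτ'.2.eq_or_lt with h' | h'
      · have := he.injOn (hmem τ hτ) ⟨le_rfl, h2π⟩ (by rw [hτz, ← h, h', he.periodic])
        linarith
      · have := he.injOn (hmem τ hτ) ⟨(hs0.trans hst).le.trans hτ'.1, h'⟩ (hτz.trans h.symm)
        linarith [hτ'.1]
  have hQs : ∀ z, discQuot θ z v (e s) = (P - z) / (P - v) := fun z ↦ by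
    rw [← hP, discQuot_apply hθ]
  have hQt : ∀ z, discQuot θ z v (e t) = (Q - z) / (Q - v) := fun z ↦ by
    rw [← hQ, discQuot_apply hθ]
  have hPv : P - v ≠ 0 := sub_ne_zero.2 fun h ↦ hv (by rw [← h, hP]; exact he.mem s)
  have hQv : Q - v ≠ 0 := sub_ne_zero.2 fun h ↦ hv (by rw [← h, hQ]; exact he.mem t)
  have hts := ht1.le
  have hst' := hst.le
  have hs0' := hs0.le
  have hagree : ∀ z, θ z ∉ E → m s t z = (m 0 s z * m t (2 * Real.pi) z)⁻¹ := by
    intro z hz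
    have hzT : ∀ {a b : ℝ}, θ z ∉ e '' Icc a b := fun h ↦ hz (hsubE h)
    have h1 : m 0 (2 * Real.pi) z = 1 := hone z v hz hv
    have h2 : m 0 (2 * Real.pi) z = m 0 s z * m s (2 * Real.pi) z :=
      sqrtRatio_trans hs0' (hst'.trans hts) (hcont z) (hn0 hzT)
    have h3 : m s (2 * Real.pi) z = m s t z * m t (2 * Real.pi) z :=
      sqrtRatio_trans hst' hts (hcont z) (hn0 hzT)
    refine eq_inv_of_mul_eq_one_left ?_
    rw [← h1, h2, h3]; ring
  classical
  set M : ℂ → ℂ := fun z ↦ if θ z ∉ A₁ then m s t z else (m 0 s z * m t (2 * Real.pi) z)⁻¹ with hM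
  have hM₂ : ∀ z, θ z ∉ A₂ → θ z ∉ A₃ → M z = (m 0 s z * m t (2 * Real.pi) z)⁻¹ := by
    intro z h2 h3
    by_cases h : θ z ∈ A₁
    · simp [hM, h]
    · simp only [hM, h, not_false_eq_true, if_true]
      refine hagree z fun hz ↦ ?_
      rcases hEU _ hz with h' | h' | h' <;> contradiction
  have hclosed : ∀ {a b : ℝ}, IsOpen (θ ⁻¹' (e '' Icc a b)ᶜ) := fun {a b} ↦
    ((isCompact_Icc.image he.continuous).isClosed.isOpen_compl).preimage hθ.continuous
  refine not_exists_sqrt_moebius (C := (P - v) / (Q - v)) hPQ (div_ne_zero hPv hQv) (M := M) ?_ ?_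
  · intro z hzP hzQ
    by_cases h : θ z ∈ A₁
    · obtain ⟨h2, h3⟩ := hdisj z h hzP hzQ
      have c1 : ContinuousAt (fun z ↦ (m 0 s z * m t (2 * Real.pi) z)⁻¹) z := by
        refine ContinuousAt.inv₀ ((sqrtRatio_discQuot_continuousAt hθ he.continuous hs0' h2 hvT).mul
          (sqrtRatio_discQuot_continuousAt hθ he.continuous hts h3 hvT)) ?_
        exact mul_ne_zero (sqrtRatio_ne_zero hs0' (hcont z) (hn0 h2))
          (sqrtRatio_ne_zero hts (hcont z) (hn0 h3))
      refine c1.congr ?_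
      filter_upwards [hclosed.mem_nhds h2, hclosed.mem_nhds h3] with y h2 h3 using (hM₂ y h2 h3).symm
    · refine (sqrtRatio_discQuot_continuousAt hθ he.continuous hst' h hvT).congr ?_
      filter_upwards [hclosed.mem_nhds h] with y hy
      have hy : θ y ∉ A₁ := hy
      simp [hM, hm, hy]
  · intro z hzP hzQ
    have hzP' : P - z ≠ 0 := sub_ne_zero.2 hzP.symm
    have hzQ' : Q - z ≠ 0 := sub_ne_zero.2 hzQ.symm
    by_cases h : θ z ∈ A₁
    · obtain ⟨h2, h3⟩ := hdisj z h hzP hzQ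
      rw [hM₂ z h2 h3, inv_pow, mul_pow]
      simp only [hm]
      rw [sqrtRatio_sq hs0' (hcont z) (hn0 h2), sqrtRatio_sq hts (hcont z) (hn0 h3), hQs, hQt,
        ← he.periodic]
      have hn : discQuot θ z v (e 0) ≠ 0 := hn0 h2 0 (left_mem_Icc.2 hs0')
      field_simp
    · have : M z = m s t z := by simp [hM, h]
      rw [this]
      simp only [hm]
      rw [sqrtRatio_sq hst' (hcont z) (hn0 h), hQs, hQt]
      field_simp

/-- Some point of the circle in the disc has nontrivial signs in each of its neighbourhoods. -/
theorem exists_mem_forall_discSign_ne_one (hθ : IsOpenEmbedding θ) (hE : IsCircle E)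
    (he : IsCircleParam e E) (hmeet : (E ∩ range θ).Nonempty) :
    ∃ z₀, θ z₀ ∈ E ∧ ∀ W, IsOpen W → z₀ ∈ W →
      ∃ z ∈ W, ∃ w ∈ W, θ z ∉ E ∧ θ w ∉ E ∧ discSign θ e z w ≠ 1 := by
  by_contra! hone
  obtain ⟨z, w, hz, hw, hzw⟩ := exists_discSign_ne_one hθ hE he hmeet
  refine hzw ?_
  rw [← discSign_self hθ he hw]
  refine isPreconnected_univ.eq_of_locally_eq_on_dense (hE.dense_preimage_compl hθ)
    (fun z ↦ discSign θ e z w) (fun z₀ _ ↦ ?_) ⟨mem_univ z, hz⟩ ⟨mem_univ w, hw⟩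
  have hstep : ∀ p q, θ p ∉ E → θ q ∉ E → discSign θ e p q = 1 →
      discSign θ e p w = discSign θ e q w := fun p q hp hq h ↦ by
    rw [← discSign_mul hθ he hp hq hw, h, one_mul]
  by_cases hz₀ : θ z₀ ∈ E
  · obtain ⟨W, hWo, hzW, hW⟩ := hone z₀ hz₀
    exact ⟨W, hWo, hzW, fun p hp q hq ↦ hstep p q hp.2 hq.2 (hW p hp.1 q hq.1 hp.2 hq.2)⟩
  · obtain ⟨r, hr, hrs⟩ := Metric.isOpen_iff.1
      (he.isCompact.isClosed.isOpen_compl.preimage hθ.continuous) z₀ hz₀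
    refine ⟨Metric.ball z₀ (r / 3), Metric.isOpen_ball, Metric.mem_ball_self (by positivity),
      fun p hp q hq ↦ hstep p q hp.2 hq.2 (discSign_eq_one_of_near hθ he hr ?_ hp.1 hq.1)⟩
    rw [disjoint_left]
    rintro _ ⟨ζ, hζ, rfl⟩
    exact hrs hζ

end

section

variable {S : Type*} [TopologicalSpace S] {ι : Type*}

/-- Signs attached to the points off a circle `E`, one for each disc `θ a` containing the point,
which record locally the sides of `E`. -/
structure IsSideLabel (θ : ι → ℂ → S) (E : Set S) (f : ι → S → ℂ) : Prop where
  eq_or : ∀ a, ∀ p ∈ range (θ a), p ∉ E → f a p = 1 ∨ f a p = -1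
  locally_const : ∀ a, ∀ x ∈ range (θ a), x ∉ E →
    ∃ W, IsOpen W ∧ x ∈ W ∧ ∀ p ∈ W, ∀ q ∈ W, f a p = f a q
  locally_const_mul : ∀ a b, ∀ x ∈ range (θ a) ∩ range (θ b), ∃ W, IsOpen W ∧ x ∈ W ∧
    ∀ p ∈ W, p ∉ E → ∀ q ∈ W, q ∉ E → f a p * f b p = f a q * f b q
  exists_ne : ∀ a U, IsOpen U → (E ∩ U ∩ range (θ a)).Nonempty → ∃ x ∈ E ∩ U ∩ range (θ a),
    ∀ W, IsOpen W → x ∈ W → ∃ p ∈ W, ∃ q ∈ W, p ∉ E ∧ q ∉ E ∧ f a p ≠ f a q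

theorem IsCircle.exists_sideLabel [T2Space S] {θ : ι → ℂ → S} (hθ : ∀ a, IsOpenEmbedding (θ a))
    {E : Set S} (hE : IsCircle E) : ∃ f : ι → S → ℂ, IsSideLabel θ E f := by
  obtain ⟨e, he⟩ := hE.exists_param
  have hb : ∀ a, ∃ b, θ a b ∉ E := fun a ↦ (hE.dense_preimage_compl (hθ a)).nonempty
  choose b hb using hb
  set f : ι → S → ℂ := fun a p ↦ discSign (θ a) e (Function.invFun (θ a) p) (b a) with hf
  have hfθ : ∀ a z, f a (θ a z) = discSign (θ a) e z (b a) := fun a z ↦ by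
    simp only [hf, Function.leftInverse_invFun (hθ a).injective z]
  have hmul : ∀ a z w, θ a z ∉ E → θ a w ∉ E →
      f a (θ a z) * f a (θ a w) = discSign (θ a) e z w := fun a z w hz hw ↦ by
    rw [hfθ, hfθ, discSign_comm (hθ a) he hw (hb a), discSign_mul (hθ a) he hz (hb a) hw]
  have hor : ∀ a, ∀ p ∈ range (θ a), p ∉ E → f a p = 1 ∨ f a p = -1 := by
    rintro a _ ⟨z, rfl⟩ hz
    rw [hfθ]; exact discSign_eq_or (hθ a) he hz (hb a)
  have hsq : ∀ a, ∀ p ∈ range (θ a), p ∉ E → f a p * f a p = 1 := fun a p hp hpE ↦ by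
    rcases hor a p hp hpE with h | h <;> rw [h] <;> norm_num
  refine ⟨f, hor, ?_, ?_, ?_⟩
  · rintro a _ ⟨z₀, rfl⟩ hx
    obtain ⟨r, hr, hrs⟩ := Metric.isOpen_iff.1
      (he.isCompact.isClosed.isOpen_compl.preimage (hθ a).continuous) z₀ hx
    have hsub : Metric.ball z₀ (r / 3) ⊆ Metric.ball z₀ r := Metric.ball_subset_ball (by linarith)
    refine ⟨θ a '' Metric.ball z₀ (r / 3), (hθ a).isOpenMap _ Metric.isOpen_ball,
      ⟨z₀, Metric.mem_ball_self (by positivity), rfl⟩, ?_⟩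
    rintro _ ⟨z, hz, rfl⟩ _ ⟨w, hw, rfl⟩
    have hzE : θ a z ∉ E := hrs (hsub hz)
    have hwE : θ a w ∉ E := hrs (hsub hw)
    rw [hfθ, hfθ, ← discSign_mul (hθ a) he hzE hwE (hb a),
      discSign_eq_one_of_near (hθ a) he hr ?_ hz hw, one_mul]
    rw [disjoint_left]
    rintro _ ⟨ζ, hζ, rfl⟩
    exact hrs hζ
  · rintro a c x ⟨hxa, hxc⟩
    obtain ⟨W, hW, hxW, h⟩ := exists_nhds_discSign_eq (hθ a) (hθ c) hxa hxc
    refine ⟨W ∩ (range (θ a) ∩ range (θ c)),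
      hW.inter ((hθ a).isOpen_range.inter (hθ c).isOpen_range), ⟨hxW, hxa, hxc⟩, ?_⟩
    rintro p ⟨hpW, hpa, hpc⟩ hpE q ⟨hqW, hqa, hqc⟩ hqE
    have h1 := hsq a q hqa hqE
    have h2 := hsq c p hpc hpE
    obtain ⟨z, rfl⟩ := hpa
    obtain ⟨z', hz'⟩ := hpc
    obtain ⟨w, rfl⟩ := hqa
    obtain ⟨w', hw'⟩ := hqc
    have h3 := h z w z' w' hz'.symm hw'.symm hpW hqW e E he hpE hqE
    rw [← hmul a z w hpE hqE, ← hmul c z' w' (hz' ▸ hpE) (hw' ▸ hqE), hz', hw'] at h3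
    linear_combination (f a (θ a w) * f c (θ a z)) * h3 - (f a (θ a z) * f c (θ a z)) * h1 +
      (f a (θ a w) * f c (θ a w)) * h2
  · rintro a U hU ⟨_, ⟨hxE, hxU⟩, ⟨ζ, rfl⟩⟩
    obtain ⟨ε, hε, hεs⟩ := Metric.isOpen_iff.1 (hU.preimage (hθ a).continuous) ζ hxU
    obtain ⟨β, hβ, hβ0, hβr⟩ := exists_openEmbedding_ball ζ hε
    have hθβ := (hθ a).comp hβ
    obtain ⟨z₀, hz₀E, hz₀⟩ := exists_mem_forall_discSign_ne_one hθβ hE he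
      ⟨θ a ζ, hxE, 0, by simp [hβ0]⟩
    refine ⟨θ a (β z₀), ⟨⟨hz₀E, hεs (hβr ▸ mem_range_self z₀)⟩, mem_range_self _⟩, ?_⟩
    intro W hW hxW
    obtain ⟨W', hW', hxW', h⟩ := exists_nhds_discSign_eq hθβ (hθ a) (x := θ a (β z₀)) ⟨z₀, rfl⟩
      ⟨β z₀, rfl⟩
    obtain ⟨z, hz, w, hw, hzE, hwE, hzw⟩ := hz₀ _ ((hW.inter hW').preimage hθβ.continuous)
      ⟨hxW, hxW'⟩
    refine ⟨θ a (β z), hz.1, θ a (β w), hw.1, hzE, hwE, fun heq ↦ hzw ?_⟩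
    rw [h z w (β z) (β w) rfl rfl hz.2 hw.2 e E he hzE hwE, ← hmul a _ _ hzE hwE, heq]
    exact hsq a _ (mem_range_self _) hwE

/-- There are finitely many classes of circles such that any two disjoint circles in the same
class separate the regions in which they lie. -/
theorem exists_finite_classes [T2Space S] [LocallyConnectedSpace S] [Finite ι] {θ : ι → ℂ → S}
    (hθ : ∀ a, IsOpenEmbedding (θ a)) {K : ι → Set S} (hK : ∀ a, IsCompact (K a))
    (hKθ : ∀ a, K a ⊆ range (θ a)) (hdense : ∀ E : Set S, IsCircle E → Dense Eᶜ) :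
    ∃ data : Set S → Set (ι × ι × S), (range data).Finite ∧ ∀ E E', IsCircle E → IsCircle E' →
      data E = data E' → Disjoint E E' → ∃ g : S → ℂ,
        (∀ a, ∀ x ∈ interior (K a), x ∉ E → x ∉ E' →
          (g x = 1 ∨ g x = -1) ∧ ∃ W, IsOpen W ∧ x ∈ W ∧ ∀ p ∈ W, g p = g x) ∧
        ∀ M, IsOpen M → M ⊆ ⋃ a, interior (K a) → (E ∩ M).Nonempty →
          ∃ p ∈ M, ∃ q ∈ M, p ∉ E ∧ p ∉ E' ∧ q ∉ E ∧ q ∉ E' ∧ g p ≠ g q := by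
  classical
  have hex : ∀ E : Set S, ∃ f : ι → S → ℂ, IsCircle E → IsSideLabel θ E f := fun E ↦ by
    by_cases hE : IsCircle E
    · obtain ⟨f, hf⟩ := hE.exists_sideLabel hθ
      exact ⟨f, fun _ ↦ hf⟩
    · exact ⟨fun _ _ ↦ 0, fun h ↦ absurd h hE⟩
  choose f hf using hex
  set D : ι → ι → Set S := fun a b ↦ range (θ a) ∩ range (θ b) with hD
  have hDo : ∀ a b, IsOpen (D a b) := fun a b ↦ (hθ a).isOpen_range.inter (hθ b).isOpen_range
  have hKD : ∀ a b, K a ∩ K b ⊆ D a b := fun a b ↦ inter_subset_inter (hKθ a) (hKθ b)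
  have hT : ∀ a b, ∃ t : Finset S, (∀ x ∈ t, x ∈ K a ∩ K b) ∧
      K a ∩ K b ⊆ ⋃ x ∈ t, connectedComponentIn (D a b) x := fun a b ↦
    ((hK a).inter (hK b)).elim_nhds_subcover _ fun x hx ↦
      ((hDo a b).connectedComponentIn).mem_nhds (mem_connectedComponentIn (hKD a b hx))
  choose T hTK hT using hT
  set F : Set (ι × ι × S) := ⋃ a, ⋃ b, (fun x ↦ (a, b, x)) '' (T a b : Set S) with hF
  have hFfin : F.Finite := finite_iUnion fun a ↦ finite_iUnion fun b ↦
    (T a b).finite_toSet.image _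
  set data : Set S → Set (ι × ι × S) := fun E ↦ {x | x ∈ F ∧ ∃ W, IsOpen W ∧ x.2.2 ∈ W ∧
    ∀ p ∈ W, p ∉ E → f E x.1 p * f E x.2.1 p = 1} with hdata
  refine ⟨data, hFfin.finite_subsets.subset ?_, ?_⟩
  · rintro _ ⟨E, rfl⟩ x hx
    exact hx.1
  have hprod : ∀ E, IsCircle E → ∀ a b, ∀ x ∈ D a b, x ∉ E →
      f E a x * f E b x = 1 ∨ f E a x * f E b x = -1 := by
    intro E hE a b x hx hxE
    rcases (hf E hE).eq_or a x hx.1 hxE with h1 | h1 <;>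
      rcases (hf E hE).eq_or b x hx.2 hxE with h2 | h2 <;> rw [h1, h2] <;> norm_num
  have hchar : ∀ E, IsCircle E → ∀ a b, ∀ t ∈ T a b, ∀ y ∈ connectedComponentIn (D a b) t,
      y ∉ E → (f E a y * f E b y = 1 ↔ (a, b, t) ∈ data E) := by
    intro E hE a b t ht y hy hyE
    set Q := connectedComponentIn (D a b) t with hQ
    have hQo : IsOpen Q := (hDo a b).connectedComponentIn
    have htQ : t ∈ Q := mem_connectedComponentIn (hKD a b (hTK a b t ht))
    have hQD : Q ⊆ D a b := connectedComponentIn_subset _ _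
    have hconst : ∀ p ∈ Q, p ∉ E → f E a p * f E b p = f E a y * f E b y := by
      intro p hp hpE
      refine isPreconnected_connectedComponentIn.eq_of_locally_eq_on_dense (hdense E hE)
        (fun p ↦ f E a p * f E b p) (fun x hx ↦ ?_) ⟨hp, hpE⟩ ⟨hy, hyE⟩
      obtain ⟨W, hW, hxW, h⟩ := (hf E hE).locally_const_mul a b x (hQD hx)
      exact ⟨W, hW, hxW, fun p hp q hq ↦ h p hp.1 hp.2 q hq.1 hq.2⟩
    constructor
    · intro h
      exact ⟨mem_iUnion₂.2 ⟨a, b, t, ht, rfl⟩, Q, hQo, htQ, fun p hp hpE ↦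
        (hconst p hp hpE).trans h⟩
    · rintro ⟨-, W, hW, htW, h⟩
      obtain ⟨p, ⟨hpW, hpQ⟩, hpE⟩ := (hdense E hE).inter_open_nonempty _ (hW.inter hQo)
        ⟨t, htW, htQ⟩
      rw [← hconst p hpQ hpE]
      exact h p hpW hpE
  intro E E' hE hE' hEE' hdisj
  have hkey : ∀ a b, ∀ y ∈ K a ∩ K b, y ∉ E → y ∉ E' →
      f E a y * f E b y = f E' a y * f E' b y := by
    intro a b y hy hyE hyE'
    obtain ⟨t, ht, hyt⟩ := mem_iUnion₂.1 (hT a b hy)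
    have h1 := hchar E hE a b t ht y hyt hyE
    have h2 := hchar E' hE' a b t ht y hyt hyE'
    rw [hEE'] at h1
    have h3 := h1.trans h2.symm
    rcases hprod E hE a b y (hKD a b hy) hyE with h | h
    · rw [h, h3.1 h]
    · rcases hprod E' hE' a b y (hKD a b hy) hyE' with h' | h'
      · rw [h3.2 h', h']
      · rw [h, h']
  set g : S → ℂ := fun p ↦ if h : ∃ a, p ∈ K a then f E h.choose p * f E' h.choose p else 0 with hg
  have hgf : ∀ a, ∀ p ∈ K a, p ∉ E → p ∉ E' → g p = f E a p * f E' a p := by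
    intro a p hp hpE hpE'
    have hp' : ∃ a, p ∈ K a := ⟨a, hp⟩
    have h1 := hkey a hp'.choose p ⟨hp, hp'.choose_spec⟩ hpE hpE'
    simp only [hg, dif_pos hp']
    rcases (hf E hE).eq_or a p (hKθ a hp) hpE with h2 | h2 <;>
      rcases (hf E' hE').eq_or a p (hKθ a hp) hpE' with h3 | h3 <;>
      rcases (hf E hE).eq_or _ p (hKθ _ hp'.choose_spec) hpE with h4 | h4 <;>
      rcases (hf E' hE').eq_or _ p (hKθ _ hp'.choose_spec) hpE' with h5 | h5 <;>
      simp only [h2, h3, h4, h5] at h1 ⊢ <;> first | (norm_num; done) | (exfalso; norm_num at h1)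
  have hopen : ∀ {E : Set S}, IsCircle E → IsOpen Eᶜ := fun hE ↦ by
    obtain ⟨e, he⟩ := hE.exists_param
    exact he.isCompact.isClosed.isOpen_compl
  refine ⟨g, ?_, ?_⟩
  · intro a x hx hxE hxE'
    have hxK := interior_subset hx
    refine ⟨?_, ?_⟩
    · rw [hgf a x hxK hxE hxE']
      rcases (hf E hE).eq_or a x (hKθ a hxK) hxE with h2 | h2 <;>
      rcases (hf E' hE').eq_or a x (hKθ a hxK) hxE' with h3 | h3 <;> rw [h2, h3] <;> norm_num
    · obtain ⟨W, hW, hxW, h⟩ := (hf E hE).locally_const a x (hKθ a hxK) hxE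
      obtain ⟨W', hW', hxW', h'⟩ := (hf E' hE').locally_const a x (hKθ a hxK) hxE'
      refine ⟨W ∩ W' ∩ (interior (K a) ∩ (Eᶜ ∩ E'ᶜ)),
        (hW.inter hW').inter (isOpen_interior.inter ((hopen hE).inter (hopen hE'))),
        ⟨⟨hxW, hxW'⟩, hx, hxE, hxE'⟩, ?_⟩
      rintro p ⟨⟨hpW, hpW'⟩, hp, hpE, hpE'⟩
      rw [hgf a x hxK hxE hxE', hgf a p (interior_subset hp) hpE hpE', h p hpW x hxW,
        h' p hpW' x hxW']
  · rintro M hM hMK ⟨x₁, hx₁E, hx₁M⟩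
    obtain ⟨a, hx₁a⟩ := mem_iUnion.1 (hMK hx₁M)
    obtain ⟨x, ⟨⟨hxE, ⟨hxM, hxK⟩, hxE'⟩, hxa⟩, h⟩ := (hf E hE).exists_ne a
      (M ∩ interior (K a) ∩ E'ᶜ) ((hM.inter isOpen_interior).inter (hopen hE'))
      ⟨x₁, ⟨hx₁E, ⟨hx₁M, hx₁a⟩, disjoint_left.1 hdisj hx₁E⟩, hKθ a (interior_subset hx₁a)⟩
    obtain ⟨W', hW', hxW', h'⟩ := (hf E' hE').locally_const a x hxa hxE'
    obtain ⟨p, ⟨⟨⟨hpM, hpK⟩, hpE'⟩, hpW'⟩, q, ⟨⟨⟨hqM, hqK⟩, hqE'⟩, hqW'⟩, hpE, hqE, hne⟩ :=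
      h (M ∩ interior (K a) ∩ E'ᶜ ∩ W')
        (((hM.inter isOpen_interior).inter (hopen hE')).inter hW') ⟨⟨⟨hxM, hxK⟩, hxE'⟩, hxW'⟩
    refine ⟨p, hpM, q, hqM, hpE, hpE', hqE, hqE', ?_⟩
    rw [hgf a p (interior_subset hpK) hpE hpE', hgf a q (interior_subset hqK) hqE hqE',
      h' p hpW' q hqW']
    refine fun heq ↦ hne (mul_right_cancel₀ ?_ heq)
    rcases (hf E' hE').eq_or a q (hKθ a (interior_subset hqK)) hqE' with h | h <;> rw [h] <;>
      norm_num

end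

/-! ### Continua -/

section

variable {S : Type*} [TopologicalSpace S]

theorem IsCircle.isCompact {E : Set S} (hE : IsCircle E) : IsCompact E := by
  obtain ⟨e, he⟩ := hE.exists_param
  exact he.isCompact

theorem IsCircle.isConnected {E : Set S} (hE : IsCircle E) : IsConnected E := by
  obtain ⟨e, he⟩ := hE.exists_param
  rw [← he.range_eq]
  exact isConnected_range he.continuous

/-- Boundary bumping. -/
theorem exists_subcontinuum_meeting_frontier [T2Space S] {D N : Set S} {a : S} (hD : IsCompact D)
    (hD' : IsPreconnected D) (hN : IsOpen N) (haD : a ∈ D) (haN : a ∈ N) (hDN : ¬ D ⊆ N) :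
    ∃ C ⊆ D ∩ closure N, IsCompact C ∧ IsPreconnected C ∧ a ∈ C ∧ (C ∩ frontier N).Nonempty := by
  set X := D ∩ closure N with hX
  have hXc : IsCompact X := hD.inter_right isClosed_closure
  have haX : a ∈ X := ⟨haD, subset_closure haN⟩
  have : CompactSpace X := isCompact_iff_compactSpace.1 hXc
  set Y : Set X := connectedComponent ⟨a, haX⟩ with hY
  refine ⟨Subtype.val '' Y, by rintro _ ⟨y, -, rfl⟩; exact y.2,
    isClosed_connectedComponent.isCompact.image continuous_subtype_val,
    isPreconnected_connectedComponent.image _ continuous_subtype_val.continuousOn,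
    ⟨_, mem_connectedComponent, rfl⟩, ?_⟩
  by_contra hne
  have hsub : Y ⊆ Subtype.val ⁻¹' N := by
    intro y hy
    by_contra hyN
    exact hne ⟨y, ⟨y, hy, rfl⟩, hN.frontier_eq ▸ ⟨y.2.2, hyN⟩⟩
  obtain ⟨Z, hZ, hYZ, hZN⟩ : ∃ Z : Set X, IsClopen Z ∧ ⟨a, haX⟩ ∈ Z ∧ Z ⊆ Subtype.val ⁻¹' N := by
    rw [hY, connectedComponent_eq_iInter_isClopen] at hsub
    have : Nonempty { s : Set X // IsClopen s ∧ (⟨a, haX⟩ : X) ∈ s } :=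
      ⟨⟨univ, isClopen_univ, mem_univ _⟩⟩
    obtain ⟨Z, hZ⟩ := exists_subset_nhds_of_compactSpace
      (V := fun s : { s : Set X // IsClopen s ∧ (⟨a, haX⟩ : X) ∈ s } ↦ (s : Set X))
      (by
        intro s t
        exact ⟨⟨s ∩ t, s.2.1.inter t.2.1, s.2.2, t.2.2⟩, inter_subset_left, inter_subset_right⟩)
      (fun s ↦ s.2.1.isClosed)
      (fun y hy ↦ (hN.preimage continuous_subtype_val).mem_nhds (hsub hy))
    exact ⟨Z, Z.2.1, Z.2.2, hZ⟩
  obtain ⟨O, hO, rfl⟩ := isOpen_induced_iff.1 hZ.isOpen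
  have hcl : IsClosed (X ∩ O) := by
    have := (hZ.isClosed.isCompact.image continuous_subtype_val).isClosed
    rwa [Subtype.image_preimage_coe] at this
  obtain ⟨y, hyD, hyN⟩ := not_subset.1 hDN
  obtain ⟨w, hwD, ⟨hwO, hwN⟩, hw⟩ := hD' (O ∩ N) (X ∩ O)ᶜ (hO.inter hN) hcl.isOpen_compl
    (fun p _ ↦ by
      by_cases hp : p ∈ X ∩ O
      · exact Or.inl ⟨hp.2, hZN (a := ⟨p, hp.1⟩) hp.2⟩
      · exact Or.inr hp)
    ⟨a, haD, hYZ, haN⟩ ⟨y, hyD, fun h ↦ hyN (hZN (a := ⟨y, h.1⟩) h.2)⟩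
  exact hw ⟨⟨hwD, subset_closure hwN⟩, hwO⟩

theorem exists_subcontinuum_disjoint [T2Space S] {X F : Set S} {𝓕 : Set (Set S)}
    (hX : IsCompact X) (hX' : IsPreconnected X) (hclosed : ∀ F ∈ 𝓕, IsClosed F)
    (hdisj : 𝓕.PairwiseDisjoint id) (hcover : X ⊆ ⋃₀ 𝓕) (hne : X.Nonempty)
    (hnot : ∀ F ∈ 𝓕, ¬ X ⊆ F) (hF : F ∈ 𝓕) :
    ∃ Y ⊆ X, IsCompact Y ∧ IsPreconnected Y ∧ Y.Nonempty ∧ (∀ F ∈ 𝓕, ¬ Y ⊆ F) ∧ Disjoint Y F := by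
  by_cases hXF : Disjoint X F
  · exact ⟨X, Subset.rfl, hX, hX', hne, hnot, hXF⟩
  obtain ⟨x, hxX, hxF⟩ := not_disjoint_iff.1 hXF
  obtain ⟨b, hbX, hbF⟩ := not_subset.1 (hnot F hF)
  obtain ⟨G, hG, hbG⟩ := hcover hbX
  have hFG : Disjoint G F := hdisj hG hF (fun h ↦ hbF (h ▸ hbG))
  obtain ⟨O, O', hO, hO', hGO, hFO', hOO'⟩ := SeparatedNhds.of_isCompact_isCompact
    (hX.inter_right (hclosed G hG)) (hX.inter_right (hclosed F hF))
    (hFG.mono inter_subset_right inter_subset_right)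
  obtain ⟨Y, hYX, hYc, hYp, hbY, y, hyY, hyO⟩ := exists_subcontinuum_meeting_frontier hX hX' hO hbX
    (hGO ⟨hbX, hbG⟩) (fun h ↦ disjoint_left.1 hOO' (h hxX) (hFO' ⟨hxX, hxF⟩))
  rw [hO.frontier_eq] at hyO
  refine ⟨Y, fun p hp ↦ (hYX hp).1, hYc, hYp, ⟨b, hbY⟩, ?_, ?_⟩
  · intro H hH hYH
    have : H = G := hdisj.elim hH hG (not_disjoint_iff.2 ⟨b, hYH hbY, hbG⟩)
    exact hyO.2 (hGO ⟨(hYX hyY).1, this ▸ hYH hyY⟩)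
  · refine disjoint_left.2 fun p hpY hpF ↦ ?_
    exact disjoint_left.1 (hOO'.closure_left hO') (hYX hpY).2 (hFO' ⟨(hYX hpY).1, hpF⟩)

/-- Sierpiński's theorem: a continuum is not a disjoint union of countably many, and at least two,
nonempty closed sets. -/
theorem exists_subset_of_countable_closed_cover [T2Space S] {X : Set S} {𝓕 : Set (Set S)}
    (hX : IsCompact X) (hX' : IsPreconnected X) (hne : X.Nonempty) (hcount : 𝓕.Countable)
    (hclosed : ∀ F ∈ 𝓕, IsClosed F) (hdisj : 𝓕.PairwiseDisjoint id) (hcover : X ⊆ ⋃₀ 𝓕) :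
    ∃ F ∈ 𝓕, X ⊆ F := by
  by_contra! hnot
  obtain ⟨x, hx⟩ := hne
  obtain ⟨F₀, hF₀, -⟩ := hcover hx
  obtain ⟨f, rfl⟩ := hcount.exists_eq_range ⟨F₀, hF₀⟩
  let T := {Y : Set S // Y ⊆ X ∧ IsCompact Y ∧ IsPreconnected Y ∧ Y.Nonempty ∧
    ∀ F ∈ range f, ¬ Y ⊆ F}
  have hstep : ∀ (n : ℕ) (Y : T), ∃ Z : T, Z.1 ⊆ Y.1 ∧ Disjoint Z.1 (f n) := by
    rintro n ⟨Y, hYX, hYc, hYp, hYne, hY⟩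
    obtain ⟨Z, hZY, h1, h2, h3, h4, h5⟩ := exists_subcontinuum_disjoint hYc hYp hclosed hdisj
      (hYX.trans hcover) hYne hY (mem_range_self n)
    exact ⟨⟨Z, hZY.trans hYX, h1, h2, h3, h4⟩, hZY, h5⟩
  choose! next hnext hnext' using hstep
  let Y : ℕ → T := fun n ↦ Nat.rec ⟨X, Subset.rfl, hX, hX', ⟨x, hx⟩, hnot⟩ (fun n Z ↦ next n Z) n
  obtain ⟨p, hp⟩ := IsCompact.nonempty_iInter_of_sequence_nonempty_isCompact_isClosed
    (fun n ↦ (Y n).1) (fun n ↦ hnext n (Y n)) (fun n ↦ (Y n).2.2.2.2.1) (Y 0).2.2.1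
    (fun n ↦ (Y n).2.2.1.isClosed)
  rw [mem_iInter] at hp
  obtain ⟨_, ⟨n, rfl⟩, hpn⟩ := hcover ((Y 0).2.1 (hp 0))
  exact disjoint_left.1 (hnext' n (Y n)) (hp (n + 1)) hpn

/-- The limit of the sets `C a` along the ultrafilter `u`. -/
def ultraLimit {ι : Type*} (u : Ultrafilter ι) (C : ι → Set S) : Set S :=
  {p | ∀ W ∈ 𝓝 p, ∀ᶠ a in u, (C a ∩ W).Nonempty}

theorem exists_mem_ultraLimit {ι : Type*} {u : Ultrafilter ι} {C : ι → Set S} {T : Set S}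
    (hT : IsCompact T) (h : ∀ᶠ a in u, (C a ∩ T).Nonempty) : ∃ p ∈ T, p ∈ ultraLimit u C := by
  obtain ⟨a₀, ha₀⟩ := h.exists
  have : Nonempty S := ⟨ha₀.some⟩
  choose! y hy using fun a (h : (C a ∩ T).Nonempty) ↦ h
  obtain ⟨p, hpT, hp⟩ := hT.ultrafilter_le_nhds (u.map y) (by
    rw [Filter.le_principal_iff]
    exact h.mono fun a ha ↦ (hy a ha).2)
  refine ⟨p, hpT, fun W hW ↦ ?_⟩
  filter_upwards [h, hp hW] with a ha haW using ⟨y a, (hy a ha).1, haW⟩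

theorem isClosed_ultraLimit {ι : Type*} (u : Ultrafilter ι) (C : ι → Set S) :
    IsClosed (ultraLimit u C) := by
  rw [← isOpen_compl_iff, isOpen_iff_mem_nhds]
  intro p hp
  simp only [ultraLimit, mem_compl_iff, mem_ofPred_eq, not_forall] at hp
  obtain ⟨W, hW, h⟩ := hp
  filter_upwards [eventually_mem_nhds_iff.2 hW] with q hq hq' using h (hq' W hq)

theorem ultraLimit_subset {ι : Type*} {u : Ultrafilter ι} {C : ι → Set S} {T : Set S}
    (hT : IsClosed T) (h : ∀ᶠ a in u, C a ⊆ T) : ultraLimit u C ⊆ T := by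
  intro p hp
  by_contra hpT
  obtain ⟨a, ⟨q, hq, hqT⟩, ha⟩ := ((hp Tᶜ (hT.isOpen_compl.mem_nhds hpT)).and h).exists
  exact hqT (ha hq)

theorem isPreconnected_ultraLimit [T2Space S] {ι : Type*} {u : Ultrafilter ι} {C : ι → Set S}
    {T : Set S} (hT : IsCompact T) (h : ∀ᶠ a in u, C a ⊆ T)
    (hC : ∀ᶠ a in u, IsPreconnected (C a)) : IsPreconnected (ultraLimit u C) := by
  have hK : IsCompact (ultraLimit u C) :=
    hT.of_isClosed_subset (isClosed_ultraLimit u C) (ultraLimit_subset hT.isClosed h)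
  rw [isPreconnected_closed_iff]
  rintro t t' ht ht' hsub ⟨p, hp, hpt⟩ ⟨p', hp', hpt'⟩
  by_contra hne
  obtain ⟨O, O', hO, hO', htO, htO', hdisj⟩ := SeparatedNhds.of_isCompact_isCompact
    (hK.inter_right ht) (hK.inter_right ht')
    (disjoint_left.2 fun q hq hq' ↦ hne ⟨q, hq.1, hq.2, hq'.2⟩)
  have hout : ∀ᶠ a in u, (C a ∩ (T \ (O ∪ O'))).Nonempty := by
    filter_upwards [h, hC, hp O (hO.mem_nhds (htO ⟨hp, hpt⟩)),
      hp' O' (hO'.mem_nhds (htO' ⟨hp', hpt'⟩))] with a haT haC haO haO'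
    by_contra hcon
    obtain ⟨q, -, hqO, hqO'⟩ := haC O O' hO hO' (fun q hq ↦ by
      by_contra hq'
      exact hcon ⟨q, hq, haT hq, hq'⟩) haO haO'
    exact disjoint_left.1 hdisj hqO hqO'
  obtain ⟨q, hq, hqK⟩ := exists_mem_ultraLimit (hT.diff (hO.union hO')) hout
  exact hq.2 ((hsub hqK).imp (fun h ↦ htO ⟨hqK, h⟩) (fun h ↦ htO' ⟨hqK, h⟩))

end

/-! ### Charts -/

section

variable {S : Type*} [TopologicalSpace S]

theorem exists_isOpenEmbedding_plane [ChartedSpace (EuclideanSpace ℝ (Fin 2)) S] {x : S} {W : Set S}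
    (hW : W ∈ 𝓝 x) : ∃ θ : ℂ → S, IsOpenEmbedding θ ∧ θ 0 = x ∧ range θ ⊆ W := by
  set φ := chartAt (EuclideanSpace ℝ (Fin 2)) x
  set h : ℂ ≃ₜ EuclideanSpace ℝ (Fin 2) :=
    Complex.orthonormalBasisOneI.repr.toHomeomorph
  have hx : x ∈ φ.source := mem_chart_source _ x
  obtain ⟨V, hVW, hV, hxV⟩ := mem_nhds_iff.1 hW
  have hT : IsOpen (h ⁻¹' (φ.target ∩ φ.symm ⁻¹' V)) :=
    (φ.symm.isOpen_inter_preimage hV).preimage h.continuous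
  obtain ⟨ε, hε, hball⟩ := Metric.isOpen_iff.1 hT (h.symm (φ x))
    (by simp [φ.map_source hx, φ.left_inv hx, hxV])
  obtain ⟨β, hβ, hβ0, hβr⟩ := exists_openEmbedding_ball (h.symm (φ x)) hε
  have hmem : ∀ z, h (β z) ∈ φ.target ∧ φ.symm (h (β z)) ∈ V := fun z ↦
    hball (hβr ▸ mem_range_self z)
  refine ⟨fun z ↦ φ.symm (h (β z)), .of_continuous_injective_isOpenMap ?_ ?_ ?_, ?_, ?_⟩
  · exact φ.symm.continuousOn.comp_continuous (h.continuous.comp hβ.continuous) fun z ↦ (hmem z).1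
  · exact fun z w hzw ↦ hβ.injective (h.injective (φ.symm.injOn (hmem z).1 (hmem w).1 hzw))
  · intro O hO
    have : (fun z ↦ φ.symm (h (β z))) '' O = φ.symm '' (h '' (β '' O)) := by
      simp only [image_image]
    rw [this]
    refine φ.symm.isOpen_image_of_subset_source (h.isOpenMap _ (hβ.isOpenMap _ hO)) ?_
    rintro _ ⟨_, ⟨z, -, rfl⟩, rfl⟩
    exact (hmem z).1
  · simp [hβ0, φ.left_inv hx]
  · rintro _ ⟨z, rfl⟩
    exact hVW (hmem z).2

theorem IsCircle.dense_compl [ChartedSpace (EuclideanSpace ℝ (Fin 2)) S] {E : Set S}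
    (hE : IsCircle E) : Dense Eᶜ := by
  rw [← interior_eq_empty_iff_dense_compl, eq_empty_iff_forall_notMem]
  intro x hx
  obtain ⟨θ, hθ, -, hr⟩ := exists_isOpenEmbedding_plane (isOpen_interior.mem_nhds hx)
  exact hE.not_range_subset hθ (hr.trans interior_subset)

theorem exists_finite_disc_cover [ChartedSpace (EuclideanSpace ℝ (Fin 2)) S] {T : Set S}
    (hT : IsCompact T) : ∃ (s : Finset S) (θ : s → ℂ → S), (∀ a, IsOpenEmbedding (θ a)) ∧
      T ⊆ ⋃ a, interior (θ a '' Metric.closedBall 0 1) := by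
  choose θ hθ h0 _ using fun x : S ↦ exists_isOpenEmbedding_plane (Filter.univ_mem : univ ∈ 𝓝 x)
  obtain ⟨s, -, hs⟩ := hT.elim_nhds_subcover (fun x ↦ interior (θ x '' Metric.closedBall 0 1))
    (fun x _ ↦ isOpen_interior.mem_nhds <| interior_mono (image_mono Metric.ball_subset_closedBall)
      (by
        rw [((hθ x).isOpenMap _ Metric.isOpen_ball).interior_eq]
        exact ⟨0, Metric.mem_ball_self one_pos, h0 x⟩))
  refine ⟨s, fun a ↦ θ a, fun a ↦ hθ a, fun x hx ↦ ?_⟩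
  obtain ⟨a, ha, hxa⟩ := mem_iUnion₂.1 (hs hx)
  exact mem_iUnion.2 ⟨⟨a, ha⟩, hxa⟩

theorem IsPreconnected.eq_of_locally_eq {α : Type*} {M : Set S} (hM : IsPreconnected M) {f : S → α}
    (h : ∀ x ∈ M, ∃ W, IsOpen W ∧ x ∈ W ∧ ∀ p ∈ W, f p = f x) {p q : S} (hp : p ∈ M) (hq : q ∈ M) :
    f p = f q := by
  refine hM.eq_of_locally_eq_on_dense dense_univ f (fun x hx ↦ ?_) ⟨hp, mem_univ _⟩ ⟨hq, mem_univ _⟩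
  obtain ⟨W, hW, hxW, h⟩ := h x hx
  exact ⟨W, hW, hxW, fun p hp q hq ↦ (h p hp.1).trans (h q hq.1).symm⟩

/-! ### Countably many bad circles -/

/-- The circle `E ⊆ N ∩ M` is joined to `q` inside `M` by connected sets that start arbitrarily
close to `E` and miss the members of `𝒞` contained in `N`. -/
structure EscapesTo (𝒞 : Set (Set S)) (N M : Set S) (q : S) (E : Set S) : Prop where
  mem : E ∈ 𝒞
  subset : E ⊆ N
  subset' : E ⊆ M
  exists_connected : ∀ V, IsOpen V → E ⊆ V → ∃ C ⊆ M, IsPreconnected C ∧ q ∈ C ∧ (C ∩ V).Nonempty ∧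
    ∀ F ∈ 𝒞, F ⊆ N → Disjoint C F

theorem countable_of_escapesTo_of_sideLabel [T2Space S] [SecondCountableTopology S]
    {𝒞 : Set (Set S)} (hcirc : ∀ C ∈ 𝒞, IsCircle C)
    (hdisj : ∀ C ∈ 𝒞, ∀ D ∈ 𝒞, C ≠ D → Disjoint C D) {N M : Set S} {q : S} (hM : IsOpen M)
    (hM' : IsPreconnected M) {𝓑 : Set (Set S)} (h𝓑 : ∀ E ∈ 𝓑, EscapesTo 𝒞 N M q E)
    (hg : ∀ E ∈ 𝓑, ∀ E' ∈ 𝓑, Disjoint E E' → ∃ g : S → ℂ,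
      (∀ x ∈ M, x ∉ E → x ∉ E' → ∃ W, IsOpen W ∧ x ∈ W ∧ ∀ p ∈ W, g p = g x) ∧
      ∃ p ∈ M, ∃ q ∈ M, p ∉ E ∧ p ∉ E' ∧ q ∉ E ∧ q ∉ E' ∧ g p ≠ g q) : 𝓑.Countable := by
  by_contra hunc
  have hinf : Infinite 𝓑 := by
    by_contra hfin
    rw [not_infinite_iff_finite] at hfin
    exact hunc (to_countable 𝓑)
  obtain ⟨e⟩ : Nonempty (𝓑 × Bool ≃ 𝓑) := by
    rw [← Cardinal.eq, Cardinal.mk_prod]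
    simp only [Cardinal.mk_bool, Cardinal.lift_uzero, Cardinal.lift_ofNat]
    exact Cardinal.mul_eq_left (Cardinal.aleph0_le_mk 𝓑)
      ((Cardinal.natCast_lt_aleph0 (n := 2)).le.trans (Cardinal.aleph0_le_mk 𝓑)) two_ne_zero
  have hed : ∀ i j, i ≠ j → Disjoint (e i : Set S) (e j) := fun i j hij ↦
    hdisj _ (h𝓑 _ (e i).2).mem _ (h𝓑 _ (e j).2).mem
      (fun h ↦ hij (e.injective (Subtype.ext h)))
  choose g hgloc hgne using fun i : 𝓑 ↦ hg (e (i, false)) (e (i, false)).2 (e (i, true))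
    (e (i, true)).2 (hed _ _ (by simp))
  have hopen : ∀ i, IsOpen (e i : Set S)ᶜ := fun i ↦
    (hcirc _ (h𝓑 _ (e i).2).mem).isCompact.isClosed.isOpen_compl
  set F : 𝓑 → Set S := fun i ↦ e (i, false) ∪ e (i, true) with hF
  have hFmem : ∀ {i p}, p ∈ F i → ∃ b, p ∈ (e (i, b) : Set S) := by
    rintro i p (h | h)
    exacts [⟨_, h⟩, ⟨_, h⟩]
  have hFo : ∀ i, IsOpen (F i)ᶜ := fun i ↦ by
    rw [hF, compl_union]
    exact (hopen _).inter (hopen _)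
  have hloc : ∀ i, ∀ x ∈ M, x ∉ F i → ∃ W, IsOpen W ∧ x ∈ W ∧ ∀ p ∈ W, g i p = g i x :=
    fun i x hx hxF ↦ hgloc i x hx (fun h ↦ hxF (Or.inl h)) (fun h ↦ hxF (Or.inr h))
  have hnear : ∀ i j, i ≠ j → ∀ x ∈ F j, ∃ V, IsOpen V ∧ x ∈ V ∧ ∀ p ∈ V, g i p = g i q := by
    intro i j hij x hx
    obtain ⟨b, hxb⟩ := hFmem hx
    have hE := h𝓑 _ (e (j, b)).2
    have hEF : ∀ p ∈ (e (j, b) : Set S), p ∉ F i := by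
      intro p hp hpF
      obtain ⟨c, hc⟩ := hFmem hpF
      exact disjoint_left.1 (hed (j, b) (i, c) (fun h ↦ hij (congrArg Prod.fst h).symm)) hp hc
    set V := {p | ∃ W, IsOpen W ∧ p ∈ W ∧ W ⊆ M ∩ (F i)ᶜ ∧ ∀ y ∈ W, g i y = g i x} with hV
    have hVo : IsOpen V := by
      rw [isOpen_iff_forall_mem_open]
      rintro p ⟨W, hW, hpW, h⟩
      exact ⟨W, fun y hy ↦ ⟨W, hW, hy, h⟩, hW, hpW⟩
    have hEV : (e (j, b) : Set S) ⊆ V := by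
      intro p hp
      obtain ⟨W, hW, hpW, h⟩ := hloc i p (hE.subset' hp) (hEF p hp)
      have hpx : g i p = g i x := (hcirc _ hE.mem).isConnected.isPreconnected.eq_of_locally_eq
        (fun y hy ↦ hloc i y (hE.subset' hy) (hEF y hy)) hp hxb
      exact ⟨W ∩ (M ∩ (F i)ᶜ), hW.inter (hM.inter (hFo i)), ⟨hpW, hE.subset' hp, hEF p hp⟩,
        inter_subset_right, fun y hy ↦ (h y hy.1).trans hpx⟩
    obtain ⟨C, hCM, hC, hqC, ⟨y, hyC, W, hW, hyW, -, hWx⟩, hCF⟩ := hE.exists_connected V hVo hEV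
    refine ⟨V, hVo, hEV hxb, fun p ⟨W', _, hpW', _, h⟩ ↦ ?_⟩
    rw [h p hpW', ← hWx y hyW]
    refine hC.eq_of_locally_eq (fun w hw ↦ hloc i w (hCM hw) fun hwF ↦ ?_) hyC hqC
    obtain ⟨c, hc⟩ := hFmem hwF
    exact disjoint_left.1 (hCF _ (h𝓑 _ (e (i, c)).2).mem (h𝓑 _ (e (i, c)).2).subset) hw hc
  set P : 𝓑 → Set S := fun i ↦ {p | p ∈ M ∧ p ∉ F i ∧ g i p ≠ g i q} with hP
  have hPo : ∀ i, IsOpen (P i) := by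
    intro i
    rw [isOpen_iff_forall_mem_open]
    rintro p ⟨hpM, hpF, hp⟩
    obtain ⟨W, hW, hpW, h⟩ := hloc i p hpM hpF
    exact ⟨W ∩ (M ∩ (F i)ᶜ), fun y hy ↦ ⟨hy.2.1, hy.2.2, (h y hy.1) ▸ hp⟩,
      hW.inter (hM.inter (hFo i)), hpW, hpM, hpF⟩
  have hPne : ∀ i, (P i).Nonempty := by
    intro i
    obtain ⟨p, hp, p', hp', h1, h2, h3, h4, h5⟩ := hgne i
    by_cases h : g i p = g i q
    · exact ⟨p', hp', fun h ↦ h.elim h3 h4, fun h' ↦ h5 (h.trans h'.symm)⟩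
    · exact ⟨p, hp, fun h ↦ h.elim h1 h2, h⟩
  have hPfar : ∀ i, ∀ x ∈ M, x ∉ F i → x ∉ P i → ∃ W, IsOpen W ∧ x ∈ W ∧ Disjoint W (P i) := by
    intro i x hxM hxF hx
    obtain ⟨W, hW, hxW, h⟩ := hloc i x hxM hxF
    refine ⟨W, hW, hxW, disjoint_left.2 fun p hp hpP ↦ hx ⟨hxM, hxF, ?_⟩⟩
    rw [← h p hp]
    exact hpP.2.2
  have hPF : ∀ i j, i ≠ j → ∀ x ∈ F j, ∃ W, IsOpen W ∧ x ∈ W ∧ Disjoint W (P i) := by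
    intro i j hij x hx
    obtain ⟨V, hV, hxV, h⟩ := hnear i j hij x hx
    exact ⟨V, hV, hxV, disjoint_left.2 fun p hp hpP ↦ hpP.2.2 (h p hp)⟩
  have hPd : ∀ i j, i ≠ j → Disjoint (P i) (P j) := by
    intro i j hij
    by_contra hnd
    obtain ⟨y, hyi, hyj⟩ := not_disjoint_iff.1 hnd
    have hqM : q ∈ M := by
      obtain ⟨C, hC, -, hq, -⟩ := (h𝓑 _ (e (i, true)).2).exists_connected univ isOpen_univ
        (subset_univ _)
      exact hC hq
    have hcov : ∀ x ∈ M, x ∉ P i ∩ P j → ∃ W, IsOpen W ∧ x ∈ W ∧ Disjoint W (P i ∩ P j) := by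
      intro x hxM hx
      by_cases hxj : x ∈ F j
      · obtain ⟨W, hW, hxW, h⟩ := hPF i j hij x hxj
        exact ⟨W, hW, hxW, h.mono_right inter_subset_left⟩
      by_cases hxi : x ∈ F i
      · obtain ⟨W, hW, hxW, h⟩ := hPF j i hij.symm x hxi
        exact ⟨W, hW, hxW, h.mono_right inter_subset_right⟩
      by_cases hxPi : x ∈ P i
      · obtain ⟨W, hW, hxW, h⟩ := hPfar j x hxM hxj (fun h ↦ hx ⟨hxPi, h⟩)
        exact ⟨W, hW, hxW, h.mono_right inter_subset_right⟩
      · obtain ⟨W, hW, hxW, h⟩ := hPfar i x hxM hxi hxPi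
        exact ⟨W, hW, hxW, h.mono_right inter_subset_left⟩
    obtain ⟨V, hV, hqV, hVP⟩ := hcov q hqM (fun h ↦ h.1.2.2 rfl)
    obtain ⟨w, -, hw, W, ⟨-, hW⟩, hwW⟩ := hM' (P i ∩ P j)
      (⋃₀ {W | IsOpen W ∧ Disjoint W (P i ∩ P j)}) ((hPo i).inter (hPo j))
      (isOpen_sUnion fun W hW ↦ hW.1)
      (fun x hxM ↦ or_iff_not_imp_left.2 fun hx ↦
        let ⟨W, hW, hxW, h⟩ := hcov x hxM hx
        ⟨W, ⟨hW, h⟩, hxW⟩)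
      ⟨y, hyi.1, hyi, hyj⟩ ⟨q, hqM, V, ⟨hV, hVP⟩, hqV⟩
    exact disjoint_left.1 hW hwW hw
  exact hunc (Pairwise.countable_of_isOpen_disjoint hPd hPo hPne)

end

section

variable {S : Type*} [TopologicalSpace S]

theorem countable_of_escapesTo [T2Space S] [SecondCountableTopology S]
    [ChartedSpace (EuclideanSpace ℝ (Fin 2)) S]
    {𝒞 : Set (Set S)} (hcirc : ∀ C ∈ 𝒞, IsCircle C)
    (hdisj : ∀ C ∈ 𝒞, ∀ D ∈ 𝒞, C ≠ D → Disjoint C D) {N M : Set S} {q : S} (hM : IsOpen M)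
    (hM' : IsPreconnected M) (hMc : IsCompact (closure M)) :
    {E | EscapesTo 𝒞 N M q E}.Countable := by
  have : LocallyConnectedSpace S :=
    ChartedSpace.locallyConnectedSpace (EuclideanSpace ℝ (Fin 2)) S
  obtain ⟨s, θ, hθ, hs⟩ := exists_finite_disc_cover hMc
  obtain ⟨data, hfin, hdata⟩ := exists_finite_classes hθ
    (fun a ↦ (isCompact_closedBall (0 : ℂ) 1).image (hθ a).continuous)
    (fun a ↦ image_subset_range _ _) (fun E hE ↦ hE.dense_compl)
  have hMs := subset_closure.trans hs
  have hsub : {E | EscapesTo 𝒞 N M q E} ⊆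
      ⋃ d ∈ range data, {E | EscapesTo 𝒞 N M q E ∧ data E = d} := fun E hE ↦
    mem_iUnion₂.2 ⟨data E, mem_range_self E, hE, rfl⟩
  refine (hfin.countable.biUnion fun d _ ↦ ?_).mono hsub
  refine countable_of_escapesTo_of_sideLabel hcirc hdisj hM hM' (fun E hE ↦ hE.1) ?_
  rintro E ⟨hE, hEd⟩ E' ⟨hE', hEd'⟩ hEE'
  obtain ⟨g, hg, hgne⟩ := hdata E E' (hcirc E hE.mem) (hcirc E' hE'.mem) (hEd.trans hEd'.symm) hEE'
  refine ⟨g, fun x hx hxE hxE' ↦ ?_, hgne M hM hMs ?_⟩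
  · obtain ⟨a, ha⟩ := mem_iUnion.1 (hMs hx)
    exact (hg a x ha hxE hxE').2
  · obtain ⟨y, hy⟩ := (hcirc E hE.mem).isConnected.nonempty
    exact ⟨y, hy, hE.subset' hy⟩

/-- The open neighbourhood `U` of `C` shows that `𝒞` is not upper semicontinuous at `C`. -/
def IsBadNhd (𝒞 : Set (Set S)) (C U : Set S) : Prop :=
  IsOpen U ∧ C ⊆ U ∧ ∀ V, IsOpen V → C ⊆ V → ∃ D ∈ 𝒞, (D ∩ V).Nonempty ∧ ¬ D ⊆ U

theorem exists_countable_nhds_family (S : Type*) [TopologicalSpace S] [T2Space S]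
    [SecondCountableTopology S] [LocallyCompactSpace S] :
    ∃ 𝒩 : Set (Set S), 𝒩.Countable ∧ (∀ N ∈ 𝒩, IsOpen N) ∧ ∀ E U, IsCompact E → IsOpen U → E ⊆ U →
      ∃ N ∈ 𝒩, E ⊆ N ∧ closure N ⊆ U ∧ IsCompact (closure N) := by
  obtain ⟨B, hBc, -, hB⟩ := TopologicalSpace.exists_countable_basis S
  refine ⟨sUnion '' {F | F.Finite ∧ F ⊆ B}, (countable_ofPred_finite_subset hBc).image _, ?_, ?_⟩
  · rintro _ ⟨F, ⟨-, hF⟩, rfl⟩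
    exact isOpen_sUnion fun W hW ↦ hB.isOpen (hF hW)
  · intro E U hE hU hEU
    obtain ⟨K, hK, hEK, hKU⟩ := exists_compact_between hE hU hEU
    obtain ⟨F, hFB, hF, hEF⟩ := hE.elim_finite_subcover_image (b := {W | W ∈ B ∧ W ⊆ K}) (c := id)
      (fun W hW ↦ hB.isOpen hW.1) (fun x hx ↦ by
        obtain ⟨W, hW, hxW, hWK⟩ := hB.exists_subset_of_mem_open (hEK hx) isOpen_interior
        exact mem_iUnion₂.2 ⟨W, ⟨hW, hWK.trans interior_subset⟩, hxW⟩)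
    have hcl : closure (⋃₀ F) ⊆ K :=
      closure_minimal (sUnion_subset fun W hW ↦ (hFB hW).2) hK.isClosed
    refine ⟨⋃₀ F, ⟨F, ⟨hF, fun W hW ↦ (hFB hW).1⟩, rfl⟩, ?_, hcl.trans hKU,
      hK.of_isClosed_subset isClosed_closure hcl⟩
    rwa [sUnion_eq_biUnion]

theorem IsBadNhd.exists_subcontinuum [T2Space S] {𝒞 : Set (Set S)} (hcirc : ∀ C ∈ 𝒞, IsCircle C)
    {E U N V : Set S} (hU : IsBadNhd 𝒞 E U) (hN : IsOpen N) (hEN : E ⊆ N) (hNU : N ⊆ U)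
    (hV : IsOpen V) (hEV : E ⊆ V) : ∃ a ∈ V ∩ N, ∃ D ∈ 𝒞, ¬ D ⊆ U ∧ ∃ C ⊆ D ∩ closure N,
      IsPreconnected C ∧ a ∈ C ∧ (C ∩ frontier N).Nonempty := by
  obtain ⟨D, hD, ⟨a, haD, haV⟩, hDU⟩ := hU.2.2 (V ∩ N) (hV.inter hN) (subset_inter hEV hEN)
  obtain ⟨C, hC, -, h⟩ := exists_subcontinuum_meeting_frontier (hcirc D hD).isCompact
    (hcirc D hD).isConnected.isPreconnected hN haD haV.2 (fun h ↦ hDU (h.trans hNU))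
  exact ⟨a, haV, D, hD, hDU, C, hC, h⟩

theorem IsBadNhd.exists_escapesTo [T2Space S] [LocallyConnectedSpace S]
    {𝒞 : Set (Set S)} (hcirc : ∀ C ∈ 𝒞, IsCircle C)
    (hdisj : ∀ C ∈ 𝒞, ∀ D ∈ 𝒞, C ≠ D → Disjoint C D) {𝒩 : Set (Set S)} (h𝒩o : ∀ N ∈ 𝒩, IsOpen N)
    (h𝒩 : ∀ E U, IsCompact E → IsOpen U → E ⊆ U →
      ∃ N ∈ 𝒩, E ⊆ N ∧ closure N ⊆ U ∧ IsCompact (closure N)) {Q : Set S} (hQ : Dense Q)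
    {E U : Set S} (hE : E ∈ 𝒞) (hU : IsBadNhd 𝒞 E U) :
    ∃ N ∈ 𝒩, ∃ O ∈ 𝒩, ∃ q ∈ Q, IsCompact (closure O) ∧
      EscapesTo 𝒞 N (connectedComponentIn O q) q E := by
  have hEc := (hcirc E hE).isCompact
  obtain ⟨x₀, hx₀⟩ := (hcirc E hE).isConnected.nonempty
  obtain ⟨O, hO, hEO, hOU, hOc⟩ := h𝒩 E U hEc hU.1 hU.2.1
  set M := connectedComponentIn O x₀ with hM
  have hMo : IsOpen M := (h𝒩o O hO).connectedComponentIn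
  have hMU : M ⊆ U := (connectedComponentIn_subset _ _).trans (subset_closure.trans hOU)
  have hEM : E ⊆ M := (hcirc E hE).isConnected.isPreconnected.subset_connectedComponentIn hx₀ hEO
  obtain ⟨N₀, hN₀, hEN₀, hN₀M, hN₀c⟩ := h𝒩 E M hEc hMo hEM
  have hN₀o := h𝒩o N₀ hN₀
  obtain ⟨N, hN, hEN, hNN₀, -⟩ := h𝒩 E N₀ hEc hN₀o hEN₀
  obtain ⟨z, hz, hzV⟩ : ∃ z ∈ frontier N₀, ∀ T ∈ 𝓝 z, ∀ V, IsOpen V → E ⊆ V →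
      ∃ C ⊆ M, IsPreconnected C ∧ (C ∩ V).Nonempty ∧ (C ∩ T).Nonempty ∧
        ∀ F ∈ 𝒞, F ⊆ N → Disjoint C F := by
    by_contra! hcon
    obtain ⟨V, hV, hEV, h⟩ := (hN₀c.of_isClosed_subset isClosed_frontier
      frontier_subset_closure).induction_on
      (p := fun T ↦ ∃ V, IsOpen V ∧ E ⊆ V ∧ ∀ C ⊆ M, IsPreconnected C → (C ∩ V).Nonempty →
        (C ∩ T).Nonempty → ¬ ∀ F ∈ 𝒞, F ⊆ N → Disjoint C F)
      ⟨univ, isOpen_univ, subset_univ _, fun C _ _ _ h ↦ by simp at h⟩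
      (fun T T' hTT' ⟨V, hV, hEV, h⟩ ↦ ⟨V, hV, hEV, fun C hC hC' hCV hCT ↦
        h C hC hC' hCV (hCT.mono (inter_subset_inter_right _ hTT'))⟩)
      (fun T T' ⟨V, hV, hEV, h⟩ ⟨V', hV', hEV', h'⟩ ↦ ⟨V ∩ V', hV.inter hV', subset_inter hEV hEV',
        fun C hC hC' hCV hCT ↦ by
          rw [inter_union_distrib_left] at hCT
          rcases union_nonempty.1 hCT with hCT | hCT
          · exact h C hC hC' (hCV.mono (inter_subset_inter_right _ inter_subset_left)) hCT
          · exact h' C hC hC' (hCV.mono (inter_subset_inter_right _ inter_subset_right)) hCT⟩)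
      (fun z hz ↦ by
        obtain ⟨T, hT, V, hV, hEV, h⟩ := hcon z hz
        refine ⟨T, mem_nhdsWithin_of_mem_nhds hT, V, hV, hEV, fun C hC hC' hCV hCT hF ↦ ?_⟩
        obtain ⟨F, hF1, hF2, hF3⟩ := h C hC hC' hCV hCT
        exact hF3 (hF F hF1 hF2))
    obtain ⟨a, ha, D, hD, hDU, C, hC, hCp, haC, hCf⟩ := hU.exists_subcontinuum hcirc hN₀o hEN₀
      (subset_closure.trans (hN₀M.trans hMU)) hV hEV
    refine h C (fun y hy ↦ hN₀M (hC hy).2) hCp ⟨a, haC, ha.1⟩ hCf fun F hF hFN ↦ ?_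
    have hDF : D ≠ F := by
      rintro rfl
      exact hDU (hFN.trans ((subset_closure.trans hNN₀).trans
        (subset_closure.trans (hN₀M.trans hMU))))
    exact (hdisj D hD F hF hDF).mono_left fun y hy ↦ (hC hy).1
  set Ω := connectedComponentIn (M \ closure N) z with hΩ
  rw [hN₀o.frontier_eq] at hz
  have hzΩ : z ∈ Ω := mem_connectedComponentIn ⟨hN₀M hz.1, fun h ↦ hz.2 (hNN₀ h)⟩
  have hΩo : IsOpen Ω := (hMo.sdiff isClosed_closure).connectedComponentIn
  have hΩM : Ω ⊆ M \ closure N := connectedComponentIn_subset _ _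
  obtain ⟨q, hqΩ, hqQ⟩ := hQ.inter_open_nonempty Ω hΩo ⟨z, hzΩ⟩
  have hMq : connectedComponentIn O q = M := (connectedComponentIn_eq (hΩM hqΩ).1).symm
  refine ⟨N, hN, O, hO, q, hqQ, hOc, hMq ▸ ⟨hE, hEN, hEM, fun V hV hEV ↦ ?_⟩⟩
  obtain ⟨C, hCM, hC, hCV, ⟨y, hyC, hyΩ⟩, hCF⟩ := hzV Ω (hΩo.mem_nhds hzΩ) V hV hEV
  refine ⟨C ∪ Ω, union_subset hCM (fun p hp ↦ (hΩM hp).1),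
    hC.union y hyC hyΩ isPreconnected_connectedComponentIn, Or.inr hqΩ,
    hCV.mono (inter_subset_inter_left _ subset_union_left), fun F hF hFN ↦ ?_⟩
  refine disjoint_union_left.2 ⟨hCF F hF hFN, disjoint_left.2 fun p hp hpF ↦ ?_⟩
  exact (hΩM hp).2 (subset_closure (hFN hpF))

theorem countable_bad [T2Space S] [SecondCountableTopology S]
    [ChartedSpace (EuclideanSpace ℝ (Fin 2)) S]
    {𝒞 : Set (Set S)} (hcirc : ∀ C ∈ 𝒞, IsCircle C)
    (hdisj : ∀ C ∈ 𝒞, ∀ D ∈ 𝒞, C ≠ D → Disjoint C D) :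
    {E | E ∈ 𝒞 ∧ ∃ U, IsBadNhd 𝒞 E U}.Countable := by
  have : LocallyCompactSpace S := ChartedSpace.locallyCompactSpace (EuclideanSpace ℝ (Fin 2)) S
  have : LocallyConnectedSpace S :=
    ChartedSpace.locallyConnectedSpace (EuclideanSpace ℝ (Fin 2)) S
  obtain ⟨𝒩, h𝒩c, h𝒩o, h𝒩⟩ := exists_countable_nhds_family S
  obtain ⟨Q, hQc, hQ⟩ := TopologicalSpace.exists_countable_dense S
  have hsub : {E | E ∈ 𝒞 ∧ ∃ U, IsBadNhd 𝒞 E U} ⊆ ⋃ N ∈ 𝒩, ⋃ O ∈ 𝒩, ⋃ q ∈ Q,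
      {E | IsCompact (closure O) ∧ EscapesTo 𝒞 N (connectedComponentIn O q) q E} := by
    rintro E ⟨hE, U, hU⟩
    obtain ⟨N, hN, O, hO, q, hq, h⟩ := hU.exists_escapesTo hcirc hdisj h𝒩o h𝒩 hQ hE
    exact mem_iUnion₂.2 ⟨N, hN, mem_iUnion₂.2 ⟨O, hO, mem_iUnion₂.2 ⟨q, hq, h⟩⟩⟩
  refine (h𝒩c.biUnion fun N hN ↦ h𝒩c.biUnion fun O hO ↦ hQc.biUnion fun q _ ↦ ?_).mono hsub
  by_cases hOc : IsCompact (closure O)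
  · exact (countable_of_escapesTo hcirc hdisj (h𝒩o O hO).connectedComponentIn
      isPreconnected_connectedComponentIn (hOc.of_isClosed_subset isClosed_closure
        (closure_mono (connectedComponentIn_subset _ _)))).mono fun E hE ↦ hE.2
  · simp [hOc]

theorem not_isBadNhd [T2Space S] [SecondCountableTopology S]
    [ChartedSpace (EuclideanSpace ℝ (Fin 2)) S] {𝒞 : Set (Set S)} (hcirc : ∀ C ∈ 𝒞, IsCircle C)
    (hdisj : ∀ C ∈ 𝒞, ∀ D ∈ 𝒞, C ≠ D → Disjoint C D) (hcover : ⋃₀ 𝒞 = univ) {E U : Set S}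
    (hE : E ∈ 𝒞) : ¬ IsBadNhd 𝒞 E U := by
  intro hU
  have : LocallyCompactSpace S := ChartedSpace.locallyCompactSpace (EuclideanSpace ℝ (Fin 2)) S
  have hcompact : ∀ {C}, C ∈ 𝒞 → IsCompact C := fun hC ↦ (hcirc _ hC).isCompact
  obtain ⟨K₀, hK₀, hEK₀, hK₀U⟩ := exists_compact_between (hcompact hE) hU.1 hU.2.1
  set N := interior K₀ with hN
  have hNo : IsOpen N := isOpen_interior
  have hclN : closure N ⊆ K₀ := closure_minimal interior_subset hK₀.isClosed
  have hNc : IsCompact (closure N) := hK₀.of_isClosed_subset isClosed_closure hclN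
  set A := {a | ∃ D ∈ 𝒞, a ∈ D ∧ ∃ C ⊆ D ∩ closure N, IsPreconnected C ∧ a ∈ C ∧
    (C ∩ frontier N).Nonempty} with hA
  obtain ⟨x, hxE, hxA⟩ : (E ∩ closure A).Nonempty := by
    by_contra hne
    obtain ⟨a, ha, D, hD, -, C, hC, h⟩ := hU.exists_subcontinuum hcirc hNo hEK₀
      (interior_subset.trans hK₀U) isClosed_closure.isOpen_compl
      (fun x hx hxA ↦ hne ⟨x, hx, hxA⟩ : E ⊆ (closure A)ᶜ)
    exact ha.1 (subset_closure ⟨D, hD, (hC h.2.1).1, C, hC, h⟩)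
  have : (𝓝[A] x).NeBot := mem_closure_iff_nhdsWithin_neBot.1 hxA
  set u := Ultrafilter.of (𝓝[A] x) with hu
  have hux : (u : Filter S) ≤ 𝓝[A] x := Ultrafilter.of_le _
  have huA : ∀ᶠ a in u, a ∈ A := hux self_mem_nhdsWithin
  choose! D hD haD C hCD hC haC hCf using fun a (ha : a ∈ A) ↦ ha
  have hCN : ∀ᶠ a in u, C a ⊆ closure N := huA.mono fun a ha y hy ↦ (hCD a ha hy).2
  set K := ultraLimit u C with hK
  have hKc : IsCompact K :=
    hNc.of_isClosed_subset (isClosed_ultraLimit u C) (ultraLimit_subset isClosed_closure hCN)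
  have hKp : IsPreconnected K := isPreconnected_ultraLimit hNc hCN (huA.mono hC)
  have hxK : x ∈ K := by
    intro W hW
    filter_upwards [huA, hux (mem_nhdsWithin_of_mem_nhds hW)] with a ha haW
      using ⟨a, haC a ha, haW⟩
  obtain ⟨z, hzN, hzK⟩ := exists_mem_ultraLimit (hNc.of_isClosed_subset isClosed_frontier
    frontier_subset_closure) (huA.mono hCf)
  have hKbad : K ⊆ ⋃₀ {E | E ∈ 𝒞 ∧ ∃ U, IsBadNhd 𝒞 E U} := by
    intro p hp
    obtain ⟨E', hE', hpE'⟩ : p ∈ ⋃₀ 𝒞 := hcover ▸ mem_univ p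
    refine ⟨E', ⟨hE', ?_⟩, hpE'⟩
    by_cases hEE' : E = E'
    · exact ⟨U, hEE' ▸ hU⟩
    by_contra hgood
    obtain ⟨O, O', hO, hO', hEO, hEO', hOO'⟩ := SeparatedNhds.of_isCompact_isCompact
      (hcompact hE) (hcompact hE') (hdisj E hE E' hE' hEE')
    refine hgood ⟨O', hO', hEO', fun V hV hEV ↦ ?_⟩
    have huO : ∀ᶠ a in u, a ∈ O := hux (mem_nhdsWithin_of_mem_nhds (hO.mem_nhds (hEO hxE)))
    obtain ⟨a, haA, haO, y, hyC, hyV⟩ :=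
      (huA.and (huO.and (hp V (hV.mem_nhds (hEV hpE'))))).exists
    exact ⟨D a, hD a haA, ⟨y, (hCD a haA hyC).1, hyV⟩,
      fun h ↦ disjoint_left.1 hOO' haO (h (haD a haA))⟩
  obtain ⟨F, hF, hKF⟩ := exists_subset_of_countable_closed_cover hKc hKp ⟨x, hxK⟩
    (countable_bad hcirc hdisj) (fun F hF ↦ (hcompact hF.1).isClosed)
    (fun F hF F' hF' h ↦ hdisj F hF.1 F' hF'.1 h) hKbad
  have hFE : F = E := by
    by_contra h
    exact disjoint_left.1 (hdisj F hF.1 E hE h) (hKF hxK) hxE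
  rw [hNo.frontier_eq] at hzN
  exact hzN.2 (hEK₀ (hFE ▸ hKF hzK))

end

/-- Any circle decomposition of a boundaryless surface is upper semicontinuous. -/
theorem circle_decomposition_boundaryless_usc
    {S : Type*} [TopologicalSpace S] [T2Space S] [SecondCountableTopology S]
    [ConnectedSpace S] [Nonempty S] [ChartedSpace (EuclideanSpace ℝ (Fin 2)) S]
    (𝒞 : Set (Set S)) (h𝒞 : IsCircleDecomposition 𝒞) :
    IsUpperSemicontinuousDecomposition 𝒞 := by
  intro C hC U hU hCU
  by_contra! hcon
  refine not_isBadNhd h𝒞.1 h𝒞.2.1 h𝒞.2.2 hC ⟨hU, hCU, fun V hV hCV ↦ ?_⟩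
  obtain ⟨D, hD, hDV, hDU⟩ := hcon V hV hCV
  exact ⟨D, hD, hDV, hDU⟩
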